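/- Let G be a finite group with |G| = |L₃(61)| = 2⁵·3²·5²·13·31·61³·97 and degree pattern D(G) = D(L₃(61)) = (4,2,4,1,2,2,1), i.e., deg_G(2)=4, deg_G(3)=2, deg_G(5)=4, deg_G(13)=1, deg_G(31)=2, deg_G(61)=2, deg_G(97)=1. Then G is isomorphic to L₃(61). -/

import Mathlib

open scoped MatrixGroups

/-- Two distinct primes `p` and `q` dividing `|G|` are adjacent in the prime graph `Γ(G)`
of a finite group `G` iff `G` has an element of order `p * q`. -/
def primeGraphAdj (G : Type*) [Group G] (p q : ℕ) : Prop :=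
  p ≠ q ∧ p.Prime ∧ q.Prime ∧ p ∣ Nat.card G ∧ q ∣ Nat.card G ∧ ∃ g : G, orderOf g = p * q

open scoped Classical in
/-- The degree of a vertex `p` in the prime graph of `G`: the number of primes dividing `|G|`
that are adjacent to `p`. -/
noncomputable def primeGraphDeg (G : Type*) [Group G] (p : ℕ) : ℕ :=
  ((Nat.card G).primeFactors.filter (fun r => primeGraphAdj G p r)).card

open scoped MatrixGroups LinearAlgebra.Projectivization

namespace ODL3

set_option maxHeartbeats 2000000 in
open Matrix Matrix.SpecialLinearGroup in
lemma diag2n_eq {F : Type*} [Field F] {i j : Fin 3} (hij : i ≠ j) {a : F} (ha : a ≠ 0) :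
    diag2n hij a ha = transvection hij a * transvection hij.symm (-a⁻¹) * transvection hij a *
      (transvection hij (-1) * transvection hij.symm 1 * transvection hij (-1)) := by
  apply Subtype.ext
  simp only [coe_mul, transvection_coe, diag2n_coe]
  ext k l
  fin_cases i <;> fin_cases j <;> first | (exact absurd rfl hij) | skip
  all_goals
    fin_cases k <;> fin_cases l <;>
      simp [Matrix.mul_apply, Fin.sum_univ_three, Matrix.one_apply, Matrix.single_apply,
        ha]

open Matrix Matrix.SpecialLinearGroup in
theorem psl_ident (p : ℕ) [Fact p.Prime] (G : Type*) [Group G] [Finite G] {L : Type*}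
    [MulAction G L] (φ : L ≃ ℙ (ZMod p) (Fin 3 → ZMod p))
    (hcard : Nat.card G ≤ Nat.card PSL(3, ZMod p))
    (htr : ∀ (i j : Fin 3) (hij : i ≠ j) (s : ZMod p), ∃ g : G, ∀ x : L,
      φ (g • x) = (transvection hij s : SpecialLinearGroup (Fin 3) (ZMod p)) • φ x) :
    Nonempty (G ≃* PSL(3, ZMod p)) := by
  have hmul : ∀ A B : SpecialLinearGroup (Fin 3) (ZMod p),
      (∃ g : G, ∀ x : L, φ (g • x) = A • φ x) → (∃ g : G, ∀ x : L, φ (g • x) = B • φ x) →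
      ∃ g : G, ∀ x : L, φ (g • x) = (A * B) • φ x := by
    rintro A B ⟨g, hg⟩ ⟨h, hh⟩
    exact ⟨g * h, fun x => by rw [mul_smul, hg, hh, mul_smul]⟩
  have hall : ∀ M : SpecialLinearGroup (Fin 3) (ZMod p),
      ∃ g : G, ∀ x : L, φ (g • x) = M • φ x := by
    intro M
    refine diagonal_transvection_induction' _ M ?_ htr hmul
    intro i j hij c hc
    rw [diag2n_eq hij hc]
    exact hmul _ _ (hmul _ _ (hmul _ _ (htr _ _ _ _) (htr _ _ _ _)) (htr _ _ _ _))
      (hmul _ _ (hmul _ _ (htr _ _ _ _) (htr _ _ _ _)) (htr _ _ _ _))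
  let ρ : G →* Equiv.Perm (ℙ (ZMod p) (Fin 3 → ZMod p)) :=
    (φ.permCongrHom.toMonoidHom).comp (MulAction.toPermHom G L)
  have hρ : ∀ g x, ρ g x = φ (g • φ.symm x) := fun g x => rfl
  let τ := Projectivization.PSLAction.toPermHom (ι := Fin 3) (K := ZMod p)
  have hτ : Function.Injective τ := Matrix.ProjectiveSpecialLinearGroup.toPermHom_injective
  have hle : τ.range ≤ ρ.range := by
    rintro _ ⟨M, rfl⟩
    obtain ⟨M, rfl⟩ := QuotientGroup.mk_surjective M
    obtain ⟨g, hg⟩ := hall M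
    refine ⟨g, ?_⟩
    ext1 x
    rw [hρ, hg, Equiv.apply_symm_apply]
    rfl
  have h1 : Nat.card τ.range = Nat.card PSL(3, ZMod p) :=
    (Nat.card_congr (MonoidHom.ofInjective hτ).toEquiv).symm
  have h2 : Nat.card ρ.range ≤ Nat.card G :=
    Nat.card_le_card_of_surjective _ ρ.rangeRestrict_surjective
  have h3 : τ.range = ρ.range := Subgroup.eq_of_le_of_card_ge hle (by omega)
  have h4 : Nat.card ρ.range = Nat.card G := by
    have h5 : Nat.card τ.range = Nat.card ρ.range := by rw [h3]
    omega
  have h5 : Function.Injective ρ := by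
    have := (Nat.bijective_iff_surjective_and_card ρ.rangeRestrict).2
      ⟨ρ.rangeRestrict_surjective, h4.symm⟩
    intro a b hab
    exact this.1 (Subtype.ext hab)
  exact ⟨(MonoidHom.ofInjective h5).trans
    ((MulEquiv.subgroupCongr h3.symm).trans (MonoidHom.ofInjective hτ).symm)⟩

end ODL3

open scoped MatrixGroups

namespace ODL3

open Matrix in
theorem card_psl_ge [Fact (Nat.Prime 61)] :
    2 ^ 5 * 3 ^ 2 * 5 ^ 2 * 13 * 31 * 61 ^ 3 * 97 ≤ Nat.card PSL(3, ZMod 61) := by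
  have h1 : Nat.card (GL (Fin 3) (ZMod 61)) = (61 ^ 3 - 1) * (61 ^ 3 - 61) * (61 ^ 3 - 61 ^ 2) := by
    rw [Matrix.card_GL_field]
    simp [Fin.prod_univ_three]
  let d : GL (Fin 3) (ZMod 61) →* (ZMod 61)ˣ := GeneralLinearGroup.det
  have hu : Nat.card (ZMod 61)ˣ = 60 := by
    rw [Nat.card_eq_fintype_card, ZMod.card_units]
  have h2 : Nat.card d.ker * 60 = Nat.card (GL (Fin 3) (ZMod 61)) := by
    rw [← Subgroup.card_mul_index d.ker, Subgroup.index_ker,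
      MonoidHom.range_eq_top.2 GeneralLinearGroup.det_surjective, Subgroup.card_top, hu]
  have h3 : Nat.card d.ker ≤ Nat.card (SpecialLinearGroup (Fin 3) (ZMod 61)) := by
    refine Nat.card_le_card_of_injective
      (fun g : d.ker => (⟨(g.1 : Matrix _ _ _), ?_⟩ : SpecialLinearGroup (Fin 3) (ZMod 61))) ?_
    · have := g.2
      rw [MonoidHom.mem_ker] at this
      have := congrArg Units.val this
      simpa [d] using this
    · intro a b hab
      have := congrArg Subtype.val hab
      exact Subtype.ext (Units.ext this)
  have h4 : Nat.card (Subgroup.center (SpecialLinearGroup (Fin 3) (ZMod 61))) ≤ 3 := by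
    rw [Nat.card_congr (SpecialLinearGroup.center_equiv_rootsOfUnity' (0 : Fin 3)).toEquiv]
    exact card_rootsOfUnity _ _
  have h5 := Subgroup.card_eq_card_quotient_mul_card_subgroup
    (Subgroup.center (SpecialLinearGroup (Fin 3) (ZMod 61)))
  have h1' : Nat.card (GL (Fin 3) (ZMod 61)) = 63884982751200 * 180 := by
    rw [h1]; norm_num
  have h0 : 2 ^ 5 * 3 ^ 2 * 5 ^ 2 * 13 * 31 * 61 ^ 3 * 97 = 63884982751200 := by norm_num
  rw [h0]
  have h6 : Nat.card (SpecialLinearGroup (Fin 3) (ZMod 61)) ≤ Nat.card PSL(3, ZMod 61) * 3 := by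
    rw [h5]; exact Nat.mul_le_mul_left _ h4
  omega

end ODL3

open scoped MatrixGroups LinearAlgebra.Projectivization

namespace ODL3

set_option linter.unusedSectionVars false

/-- The hypotheses of the geometric part: a finite group acting on a set of `p^2+p+1` points, with
a conjugation-invariant family of subgroups of order `p^2`. -/
structure Geo (p : ℕ) (G : Type*) [Group G] (L : Type*) [MulAction G L]
    (D : L → Subgroup G) (l0 : L) (E : ZMod p × ZMod p → G) : Prop where
  trans : ∀ x y : L, ∃ g : G, g • x = y
  le_stab : ∀ l, ∀ d ∈ D l, d • l = l
  conj : ∀ (g : G) l, ∀ d ∈ D l, g * d * g⁻¹ ∈ D (g • l)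
  Eadd : ∀ u v, E (u + v) = E u * E v
  Einj : Function.Injective E
  Erange : ∀ g, g ∈ D l0 ↔ ∃ u, E u = g
  homog : ∀ a ∈ D l0, ∀ b ∈ D l0, a ≠ 1 → b ≠ 1 → ∃ g : G, g • l0 = l0 ∧ g * a * g⁻¹ = b
  nofix : ∀ l x, x ≠ l → ∃ d ∈ D l, d • x ≠ x
  cardL : Nat.card L = p ^ 2 + p + 1

namespace Geo

variable {p : ℕ} [hp : Fact p.Prime] {G : Type*} [Group G] [Finite G] {L : Type*} [Finite L]
  [MulAction G L] {D : L → Subgroup G} {l0 : L} {E : ZMod p × ZMod p → G}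

/-- Fixed points of an element. -/
def Fx (L : Type*) {G : Type*} [Group G] [MulAction G L] (a : G) : Set L := {x | a • x = x}

/-- Lines are fixed-point sets of nontrivial elements of the groups `D l`. -/
def IsLine (D : L → Subgroup G) (M : Set L) : Prop :=
  ∃ l, ∃ a ∈ D l, a ≠ 1 ∧ M = Fx L a

theorem E0 (H : Geo p G L D l0 E) : E 0 = 1 := by
  have := H.Eadd 0 0
  simpa using this

theorem D_conj_mem (H : Geo p G L D l0 E) (g : G) (l : L) (d : G) :
    d ∈ D (g • l) ↔ g⁻¹ * d * g ∈ D l := by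
  constructor
  · intro h
    have := H.conj g⁻¹ _ d h
    simpa using this
  · intro h
    have := H.conj g _ _ h
    simpa [mul_assoc] using this

theorem D_comm (H : Geo p G L D l0 E) (l : L) : ∀ a ∈ D l, ∀ b ∈ D l, a * b = b * a := by
  obtain ⟨g, rfl⟩ := H.trans l0 l
  intro a ha b hb
  rw [H.D_conj_mem, H.Erange] at ha hb
  obtain ⟨u, hu⟩ := ha
  obtain ⟨v, hv⟩ := hb
  have h := H.Eadd u v
  rw [add_comm, H.Eadd, hu, hv] at h
  have h2 := congrArg (fun x => g * x * g⁻¹) h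
  simpa [mul_assoc] using h2.symm

theorem D_pow (H : Geo p G L D l0 E) (l : L) : ∀ a ∈ D l, a ^ p = 1 := by
  obtain ⟨g, rfl⟩ := H.trans l0 l
  intro a ha
  rw [H.D_conj_mem, H.Erange] at ha
  obtain ⟨u, hu⟩ := ha
  have h : ∀ n : ℕ, E (n • u) = (E u) ^ n := by
    intro n
    induction n with
    | zero => simp [H.E0]
    | succ n ih => rw [succ_nsmul, H.Eadd, ih, pow_succ]
  have h1 := h p
  have h2 : p • u = 0 := by
    ext <;> simp
  rw [h2, H.E0, hu] at h1
  have h3 : (g⁻¹ * a * g) ^ p = g⁻¹ * a ^ p * g := by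
    have := conj_pow (i := p) (a := g⁻¹) (b := a)
    simpa using this
  rw [h3] at h1
  have : a ^ p = g * (g⁻¹ * a ^ p * g) * g⁻¹ := by group
  rw [this, ← h1]; group

theorem D_card (H : Geo p G L D l0 E) (l : L) : Nat.card (D l) = p ^ 2 := by
  have h0 : Nat.card (D l0) = p ^ 2 := by
    have e : (ZMod p × ZMod p) ≃ D l0 := Equiv.ofBijective
      (fun u => ⟨E u, (H.Erange _).2 ⟨u, rfl⟩⟩)
      ⟨fun u v h => H.Einj (congrArg Subtype.val h), fun ⟨g, hg⟩ => by
        obtain ⟨u, hu⟩ := (H.Erange _).1 hg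
        exact ⟨u, Subtype.ext hu⟩⟩
    rw [← Nat.card_congr e, Nat.card_prod, Nat.card_zmod, sq]
  obtain ⟨g, rfl⟩ := H.trans l0 l
  rw [← h0]
  refine Nat.card_congr ⟨fun d => ⟨g⁻¹ * d * g, (H.D_conj_mem _ _ _).1 d.2⟩,
    fun d => ⟨g * d * g⁻¹, H.conj _ _ _ d.2⟩, ?_, ?_⟩
  · intro d; simp [mul_assoc]
  · intro d; simp [mul_assoc]

theorem homog' (H : Geo p G L D l0 E) (l : L) : ∀ a ∈ D l, ∀ b ∈ D l, a ≠ 1 → b ≠ 1 →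
    ∃ g : G, g • l = l ∧ g * a * g⁻¹ = b := by
  obtain ⟨g, rfl⟩ := H.trans l0 l
  intro a ha b hb ha1 hb1
  rw [H.D_conj_mem] at ha hb
  obtain ⟨k, hk, hk2⟩ := H.homog _ ha _ hb (by
      intro h; apply ha1; simpa [mul_assoc, inv_mul_eq_one, mul_eq_one_iff_eq_inv] using h) (by
      intro h; apply hb1; simpa [mul_assoc, inv_mul_eq_one, mul_eq_one_iff_eq_inv] using h)
  refine ⟨g * k * g⁻¹, ?_, ?_⟩
  · simp [mul_smul, hk]
  · have := congrArg (fun x => g * x * g⁻¹) hk2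
    simpa [mul_assoc] using this

theorem Fx_conj (g a : G) (x : L) : x ∈ Fx L (g * a * g⁻¹) ↔ g⁻¹ • x ∈ Fx L a := by
  simp only [Fx, Set.mem_ofPred_eq, mul_smul]
  constructor
  · intro h
    have := congrArg (g⁻¹ • ·) h
    simpa using this
  · intro h
    rw [h]; simp

theorem Fx_conj_ncard (g a : G) : (Fx L (g * a * g⁻¹)).ncard = (Fx L a).ncard := by
  have : Fx L (g * a * g⁻¹) = (fun x => g • x) '' Fx L a := by
    ext x
    rw [Fx_conj]
    constructor
    · intro h; exact ⟨g⁻¹ • x, h, by simp⟩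
    · rintro ⟨y, hy, rfl⟩; simpa using hy
  rw [this, Set.ncard_image_of_injective _ (MulAction.injective g)]

/-- the stabilizer of `x` in `D l`. -/
def Dst (D : L → Subgroup G) (l x : L) : Subgroup G := D l ⊓ MulAction.stabilizer G x

theorem mem_Dst {l x : L} {g : G} : g ∈ Dst D l x ↔ g ∈ D l ∧ g • x = x := by
  simp [Dst, Subgroup.mem_inf, MulAction.mem_stabilizer_iff]

theorem Dst_card_le (H : Geo p G L D l0 E) {l x : L} (h : x ≠ l) :
    Nat.card (Dst D l x) ∣ p := by
  have h1 : Nat.card (Dst D l x) ∣ p ^ 2 := by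
    rw [← H.D_card l]
    exact Subgroup.card_dvd_of_le inf_le_left
  obtain ⟨k, hk, hk'⟩ := (Nat.dvd_prime_pow hp.out).1 h1
  have : k ≠ 2 := by
    rintro rfl
    have h2 : Dst D l x = D l := by
      refine Subgroup.eq_of_le_of_card_ge inf_le_left (ge_of_eq ?_)
      exact hk'.trans (H.D_card l).symm
    obtain ⟨d, hd, hd'⟩ := H.nofix l x h
    rw [← h2, mem_Dst] at hd
    exact hd' hd.2
  rw [hk']
  have : k ≤ 1 := by omega
  calc p ^ k ∣ p ^ 1 := pow_dvd_pow _ this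
    _ = p := pow_one _

theorem count (H : Geo p G L D l0 E) (l : L) :
    (∀ a ∈ D l, a ≠ 1 → (Fx L a).ncard = p + 1) ∧
    (∀ x, x ≠ l → Nat.card (Dst D l x) = p) := by
  classical
  have := Fintype.ofFinite G
  have := Fintype.ofFinite L
  have hp2 := hp.out.two_le
  -- double count
  have hdc : ∑ d : D l, (Fx L (d : G)).ncard = ∑ x : L, Nat.card (Dst D l x) := by
    have e1 : ∀ d : D l, (Fx L (d : G)).ncard = ∑ x : L, if (d : G) • x = x then 1 else 0 := by
      intro d
      rw [Finset.sum_boole, Nat.cast_id, ← Fintype.card_subtype, ← Nat.card_eq_fintype_card,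
        ← Nat.card_coe_set_eq]
      rfl
    have e2 : ∀ x : L, Nat.card (Dst D l x) = ∑ d : D l, if (d : G) • x = x then 1 else 0 := by
      intro x
      rw [Finset.sum_boole, Nat.cast_id, ← Fintype.card_subtype, ← Nat.card_eq_fintype_card]
      refine Nat.card_congr ⟨fun g => ⟨⟨g, (mem_Dst.1 g.2).1⟩, (mem_Dst.1 g.2).2⟩,
        fun g => ⟨g.1, mem_Dst.2 ⟨g.1.2, g.2⟩⟩, fun _ => rfl, fun _ => rfl⟩
    simp_rw [e1, e2]
    exact Finset.sum_comm
  have hburn : p ^ 2 ∣ ∑ d : D l, (Fx L (d : G)).ncard := by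
    have := MulAction.sum_card_fixedBy_eq_card_orbits_mul_card_group (D l) L
    rw [← Nat.card_eq_fintype_card (α := D l), H.D_card] at this
    refine ⟨_, Eq.trans ?_ (this.trans (mul_comm _ _))⟩
    apply Finset.sum_congr rfl
    intro d _
    rw [← Nat.card_eq_fintype_card, ← Nat.card_coe_set_eq]
    rfl
  obtain ⟨a0, ha0, ha01⟩ : ∃ a ∈ D l, a ≠ 1 := by
    have : Nontrivial (D l) := by
      apply Finite.one_lt_card_iff_nontrivial.1
      rw [H.D_card]; nlinarith
    obtain ⟨a, ha⟩ := exists_ne (1 : D l)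
    exact ⟨a, a.2, fun h => ha (Subtype.ext h)⟩
  set j := (Fx L a0).ncard with hj
  have hconst : ∀ a ∈ D l, a ≠ 1 → (Fx L a).ncard = j := by
    intro a ha ha1
    obtain ⟨g, hg, rfl⟩ := H.homog' l a0 ha0 a ha ha01 ha1
    rw [Fx_conj_ncard]
  have hF1 : (Fx L (1 : G)).ncard = p ^ 2 + p + 1 := by
    have : Fx L (1 : G) = Set.univ := by ext; simp [Fx]
    rw [this, Set.ncard_univ, H.cardL]
  have hsum1 : ∑ d : D l, (Fx L (d : G)).ncard = (p ^ 2 + p + 1) + (p ^ 2 - 1) * j := by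
    rw [← Finset.add_sum_erase _ _ (Finset.mem_univ (1 : D l))]
    congr 1
    rw [Finset.sum_congr rfl (g := fun _ => j)]
    · rw [Finset.sum_const, Finset.card_erase_of_mem (Finset.mem_univ _), Finset.card_univ,
        ← Nat.card_eq_fintype_card, H.D_card, smul_eq_mul]
    · intro d hd
      apply hconst _ d.2
      intro h
      exact (Finset.mem_erase.1 hd).1 (Subtype.ext h)
  have hDl : Nat.card (Dst D l l) = p ^ 2 := by
    rw [← H.D_card l]
    have : Dst D l l = D l := by
      ext g; rw [mem_Dst]
      exact ⟨fun h => h.1, fun h => ⟨h, H.le_stab _ _ h⟩⟩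
    rw [this]
  have hle : ∀ x ∈ Finset.univ.erase l, Nat.card (Dst D l x) ≤ p := by
    intro x hx
    exact Nat.le_of_dvd hp.out.pos (H.Dst_card_le (Finset.mem_erase.1 hx).1)
  have hsumP : ∑ x ∈ Finset.univ.erase l, p = (p ^ 2 + p) * p := by
    rw [Finset.sum_const, Finset.card_erase_of_mem (Finset.mem_univ _), Finset.card_univ,
      ← Nat.card_eq_fintype_card, H.cardL, smul_eq_mul]
    simp
  have hsum2 := Finset.add_sum_erase _ (fun x => Nat.card (Dst D l x)) (Finset.mem_univ l)
  simp only [hDl] at hsum2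
  have hle2 := Finset.sum_le_sum hle
  rw [hsumP] at hle2
  rw [← hdc, hsum1] at hsum2
  rw [hsum1] at hburn
  have hj1 : j ≤ p + 1 := by
    have h3 : (p ^ 2 + p + 1) + (p ^ 2 - 1) * j ≤ p ^ 2 + (p ^ 2 + p) * p := by omega
    have h4 : 1 ≤ p ^ 2 := by nlinarith
    zify [h4] at h3 ⊢
    by_contra hc
    push Not at hc
    have hp2' : (2 : ℤ) ≤ p := by exact_mod_cast hp2
    nlinarith
  have hj2 : 1 ≤ j := by
    rw [hj, Nat.one_le_iff_ne_zero]
    rw [← Nat.pos_iff_ne_zero, Set.ncard_pos]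
    exact ⟨l, H.le_stab _ _ ha0⟩
  have hj3 : j = p + 1 := by
    have h4 : 1 ≤ p ^ 2 := by nlinarith
    have hd : ((p : ℤ) ^ 2) ∣ (p + 1 - j) := by
      have h5 : ((p : ℤ) ^ 2) ∣ (p ^ 2 + p + 1) + (p ^ 2 - 1) * j := by
        have := Int.natCast_dvd_natCast.2 hburn
        push_cast [h4] at this
        exact this
      have : ((p : ℤ) + 1 - j) = ((p ^ 2 + p + 1) + (p ^ 2 - 1) * j) - p ^ 2 * (1 + j) := by ring
      rw [this]
      exact dvd_sub h5 (dvd_mul_right _ _)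
    have h6 : ((p : ℤ) + 1 - j) < p ^ 2 := by
      have : (1 : ℤ) ≤ j := by exact_mod_cast hj2
      have : (2 : ℤ) ≤ p := by exact_mod_cast hp2
      nlinarith
    have h7 := Int.eq_zero_of_dvd_of_nonneg_of_lt (by
      have : (j : ℤ) ≤ p + 1 := by exact_mod_cast hj1
      linarith) h6 hd
    omega
  refine ⟨fun a ha ha1 => (hconst a ha ha1).trans hj3, ?_⟩
  have h8 : ∑ x ∈ Finset.univ.erase l, Nat.card (Dst D l x) = ∑ x ∈ Finset.univ.erase l, p := by
    rw [hsumP]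
    have h4 : 1 ≤ p ^ 2 := by nlinarith
    rw [hj3] at hsum2
    zify [h4] at hsum2 ⊢
    linarith
  intro x hx
  exact (Finset.sum_eq_sum_iff_of_le hle).1 h8 x (Finset.mem_erase.2 ⟨hx, Finset.mem_univ _⟩)

end Geo
end ODL3

open scoped MatrixGroups LinearAlgebra.Projectivization

namespace ODL3

set_option linter.unusedSectionVars false

namespace Geo

variable {p : ℕ} [hp : Fact p.Prime] {G : Type*} [Group G] [Finite G] {L : Type*} [Finite L]
  [MulAction G L] {D : L → Subgroup G} {l0 : L} {E : ZMod p × ZMod p → G}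

theorem D_order (H : Geo p G L D l0 E) {l : L} {a : G} (ha : a ∈ D l) (h1 : a ≠ 1) :
    orderOf a = p := orderOf_eq_prime (H.D_pow l a ha) h1

theorem Dst_gen (H : Geo p G L D l0 E) {l x : L} (hx : x ≠ l) {a b : G} (ha : a ∈ Dst D l x)
    (ha1 : a ≠ 1) (hb : b ∈ Dst D l x) : b ∈ Subgroup.zpowers a := by
  have : Subgroup.zpowers a = Dst D l x := by
    refine Subgroup.eq_of_le_of_card_ge (by simpa using ha) (ge_of_eq ?_)
    rw [Nat.card_zpowers, H.D_order (mem_Dst.1 ha).1 ha1, (H.count l).2 x hx]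
  rw [this]; exact hb

theorem Fx_zpowers {a b : G} (h : b ∈ Subgroup.zpowers a) {x : L} (hx : x ∈ Fx L a) :
    x ∈ Fx L b := by
  have : Subgroup.zpowers a ≤ MulAction.stabilizer G x := by
    rw [Subgroup.zpowers_le, MulAction.mem_stabilizer_iff]; exact hx
  exact this h

theorem Dst_exists (H : Geo p G L D l0 E) {l x : L} (hx : x ≠ l) :
    ∃ a ∈ D l, a ≠ 1 ∧ a • x = x := by
  have : Nontrivial (Dst D l x) := by
    apply Finite.one_lt_card_iff_nontrivial.1
    rw [(H.count l).2 x hx]; exact hp.out.one_lt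
  obtain ⟨a, ha⟩ := exists_ne (1 : Dst D l x)
  exact ⟨a, (mem_Dst.1 a.2).1, fun h => ha (Subtype.ext h), (mem_Dst.1 a.2).2⟩

theorem Fx_eq_same (H : Geo p G L D l0 E) {l x : L} (hx : x ≠ l) {a b : G} (ha : a ∈ D l)
    (ha1 : a ≠ 1) (hax : a • x = x) (hb : b ∈ D l) (hb1 : b ≠ 1) (hbx : b • x = x) :
    Fx L a = Fx L b := by
  have h1 := H.Dst_gen hx (mem_Dst.2 ⟨ha, hax⟩) ha1 (mem_Dst.2 ⟨hb, hbx⟩)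
  have h2 := H.Dst_gen hx (mem_Dst.2 ⟨hb, hbx⟩) hb1 (mem_Dst.2 ⟨ha, hax⟩)
  ext y
  exact ⟨fun h => Fx_zpowers h1 h, fun h => Fx_zpowers h2 h⟩

theorem Fx_eq_other (H : Geo p G L D l0 E) {l x : L} (hx : x ≠ l) {a b : G} (ha : a ∈ D l)
    (ha1 : a ≠ 1) (hax : a • x = x) (hb : b ∈ D x) (hb1 : b ≠ 1) (hbl : b • l = l) :
    Fx L a = Fx L b := by
  classical
  -- `Fx a` is invariant under `b`
  have hinv : ∀ y ∈ Fx L a, b • y ∈ Fx L a := by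
    intro y hy
    have hbl' : b⁻¹ • l = l := by rw [inv_smul_eq_iff, hbl]
    have hbx : b • x = x := H.le_stab _ _ hb
    have hbx' : b⁻¹ • x = x := by rw [inv_smul_eq_iff, hbx]
    have h1 : b⁻¹ * a * b ∈ Dst D l x := by
      rw [mem_Dst]
      constructor
      · have := H.conj b⁻¹ l a ha
        simpa [hbl'] using this
      · simp [mul_smul, hbx, hax, hbx']
    have h2 := Fx_zpowers (H.Dst_gen hx (mem_Dst.2 ⟨ha, hax⟩) ha1 h1) hy
    simp only [Fx, Set.mem_ofPred_eq, mul_smul] at h2 ⊢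
    rwa [inv_smul_eq_iff] at h2
  have hbn : ∀ n : ℕ, ∀ y ∈ Fx L a, b ^ n • y ∈ Fx L a := by
    intro n
    induction n with
    | zero => intro y hy; simpa using hy
    | succ n ih => intro y hy; rw [pow_succ, mul_smul]; exact ih _ (hinv y hy)
  have hbz : ∀ g ∈ Subgroup.zpowers b, ∀ y ∈ Fx L a, g • y ∈ Fx L a := by
    intro g hg y hy
    rw [← mem_powers_iff_mem_zpowers] at hg
    obtain ⟨n, rfl⟩ := hg
    exact hbn n y hy
  let act : MulAction (Subgroup.zpowers b) (Fx L a) :=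
    { smul := fun g y => ⟨(g : G) • (y : L), hbz g g.2 y y.2⟩
      one_smul := fun y => Subtype.ext (one_smul G (y : L))
      mul_smul := fun g h y => Subtype.ext (mul_smul (g : G) h (y : L)) }
  have hsm : ∀ (g : Subgroup.zpowers b) (y : Fx L a), ((g • y : Fx L a) : L) = (g : G) • (y : L) :=
    fun g y => rfl
  have hPg : IsPGroup p (Subgroup.zpowers b) := by
    apply IsPGroup.of_card (n := 1)
    rw [Nat.card_zpowers, H.D_order hb hb1, pow_one]
  have hmod := hPg.card_modEq_card_fixedPoints (Fx L a)
  rw [Nat.card_coe_set_eq, (H.count l).1 a ha ha1] at hmod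
  have hlF : (⟨l, H.le_stab _ _ ha⟩ : Fx L a) ∈ MulAction.fixedPoints (Subgroup.zpowers b) (Fx L a) := by
    intro g
    apply Subtype.ext
    rw [hsm]
    exact Fx_zpowers g.2 hbl
  have hxF : (⟨x, hax⟩ : Fx L a) ∈ MulAction.fixedPoints (Subgroup.zpowers b) (Fx L a) := by
    intro g
    apply Subtype.ext
    rw [hsm]
    exact Fx_zpowers g.2 (H.le_stab _ _ hb)
  set s := MulAction.fixedPoints (Subgroup.zpowers b) (Fx L a) with hs
  have h2 : 2 ≤ s.ncard := by
    have : ({⟨l, H.le_stab _ _ ha⟩, ⟨x, hax⟩} : Set (Fx L a)).ncard = 2 := by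
      rw [Set.ncard_pair]
      intro h; exact hx (congrArg Subtype.val h).symm
    rw [← this]
    refine Set.ncard_le_ncard ?_ (Set.toFinite _)
    rintro y (rfl | rfl)
    · exact hlF
    · exact hxF
  rw [Nat.card_coe_set_eq] at hmod
  have h3 : p + 1 ≤ s.ncard := by
    have h4 : p ∣ s.ncard - (1 : ℕ) := by
      rw [← Nat.modEq_iff_dvd' (by omega)]
      refine Nat.ModEq.trans ?_ hmod
      simp [Nat.ModEq]
    have := Nat.le_of_dvd (by omega) h4
    omega
  have h5 : s = Set.univ := by
    apply Set.eq_of_subset_of_ncard_le (Set.subset_univ _)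
    rw [Set.ncard_univ, Nat.card_coe_set_eq, (H.count l).1 a ha ha1]
    exact h3
  refine Set.eq_of_subset_of_ncard_le ?_ ?_ (Set.toFinite _)
  · intro y hy
    have : (⟨y, hy⟩ : Fx L a) ∈ s := by rw [h5]; trivial
    have := congrArg Subtype.val (this ⟨b, Subgroup.mem_zpowers b⟩)
    exact this
  · rw [(H.count l).1 a ha ha1, (H.count x).1 b hb hb1]

theorem line_at (H : Geo p G L D l0 E) {M : Set L} (hM : IsLine D M) {x : L} (hx : x ∈ M) :
    ∃ a ∈ D x, a ≠ 1 ∧ M = Fx L a := by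
  obtain ⟨l, a, ha, ha1, rfl⟩ := hM
  by_cases h : x = l
  · subst h; exact ⟨a, ha, ha1, rfl⟩
  · obtain ⟨b, hb, hb1, hbl⟩ := H.Dst_exists (Ne.symm h)
    exact ⟨b, hb, hb1, H.Fx_eq_other h ha ha1 hx hb hb1 hbl⟩

theorem line_unique (H : Geo p G L D l0 E) {M N : Set L} (hM : IsLine D M) (hN : IsLine D N)
    {x y : L} (hxy : x ≠ y) (hxM : x ∈ M) (hyM : y ∈ M) (hxN : x ∈ N) (hyN : y ∈ N) : M = N := by
  obtain ⟨a, ha, ha1, rfl⟩ := H.line_at hM hxM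
  obtain ⟨b, hb, hb1, rfl⟩ := H.line_at hN hxN
  exact H.Fx_eq_same hxy.symm ha ha1 hyM hb hb1 hyN

theorem line_exists (H : Geo p G L D l0 E) {x y : L} (hxy : x ≠ y) :
    ∃ M, IsLine D M ∧ x ∈ M ∧ y ∈ M := by
  obtain ⟨a, ha, ha1, h⟩ := H.Dst_exists hxy.symm
  exact ⟨Fx L a, ⟨x, a, ha, ha1, rfl⟩, H.le_stab _ _ ha, h⟩

theorem line_ncard (H : Geo p G L D l0 E) {M : Set L} (hM : IsLine D M) : M.ncard = p + 1 := by
  obtain ⟨l, a, ha, ha1, rfl⟩ := hM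
  exact (H.count l).1 a ha ha1

theorem line_image (H : Geo p G L D l0 E) {M : Set L} (hM : IsLine D M) (g : G) :
    IsLine D ((fun x => g • x) '' M) := by
  obtain ⟨l, a, ha, ha1, rfl⟩ := hM
  refine ⟨g • l, g * a * g⁻¹, H.conj _ _ _ ha, by simpa using ha1, ?_⟩
  ext x
  rw [Fx_conj]
  constructor
  · rintro ⟨y, hy, rfl⟩; simpa using hy
  · intro h; exact ⟨g⁻¹ • x, h, by simp⟩

theorem line_central (H : Geo p G L D l0 E) {M : Set L} (hM : IsLine D M) {c : L} (hc : c ∈ M)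
    {d : G} (hd : d ∈ D c) {x : L} (hx : x ∈ M) : d • x ∈ M := by
  obtain ⟨a, ha, ha1, rfl⟩ := H.line_at hM hc
  simp only [Fx, Set.mem_ofPred_eq] at hx ⊢
  rw [← mul_smul, H.D_comm c a ha d hd, mul_smul, hx]

theorem exists_not_mem (H : Geo p G L D l0 E) {M N : Set L} (hM : IsLine D M) (hN : IsLine D N) 
    (hne : (M ∩ N).Nonempty) : 
    ∃ x, x ∉ M ∧ x ∉ N := by
  by_contra! h
  have : M ∪ N = Set.univ := by
    ext x; simp only [Set.mem_union, Set.mem_univ, iff_true]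
    by_cases hx : x ∈ M
    · exact Or.inl hx
    · exact Or.inr (h x hx)
  have h1 := Set.ncard_union_add_ncard_inter M N
  rw [this, Set.ncard_univ, H.cardL, H.line_ncard hM, H.line_ncard hN] at h1
  have h3 : 0 < (M ∩ N).ncard := (Set.ncard_pos).2 hne
  have := hp.out.two_le
  nlinarith

theorem exists_off_line (H : Geo p G L D l0 E) : ∃ O, IsLine D O ∧ l0 ∉ O := by
  have h2 := hp.out.two_le
  have : Nontrivial L := by
    apply Finite.one_lt_card_iff_nontrivial.1
    rw [H.cardL]; nlinarith
  obtain ⟨x, hx⟩ := exists_ne l0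
  obtain ⟨M, hM, h0, hxM⟩ := H.line_exists hx.symm
  obtain ⟨y, hy, _⟩ := H.exists_not_mem hM hM ⟨x, hxM, hxM⟩
  obtain ⟨O, hO, hxO, hyO⟩ := H.line_exists (x := x) (y := y) (fun h => hy (h ▸ hxM))
  refine ⟨O, hO, fun h => hy ?_⟩
  rw [H.line_unique hM hO hx hxM h0 hxO h]
  exact hyO

/-- transitivity of a group of order `p` on the affine part of a line. -/
theorem move (H : Geo p G L D l0 E) {N : Set L} (hN : IsLine D N)
    {c x t : L} {a : G} (ha : a ∈ D c) (ha1 : a ≠ 1) (hx : a • x ≠ x)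
    (hcN : c ∈ N) (hxN : x ∈ N) (htN : t ∈ N) (htc : t ≠ c) : ∃ k ∈ D c, k ∈ Subgroup.zpowers a ∧ k • x = t := by
  have hle : Subgroup.zpowers a ≤ D c := by simpa using ha
  have hxc : x ≠ c := by rintro rfl; exact hx (H.le_stab _ _ ha)
  let f : Subgroup.zpowers a → (N \ {c} : Set L) := fun k => ⟨(k : G) • x,
    H.line_central hN hcN (hle k.2) hxN, fun h => hxc (by
      have h' : (k : G) • x = c := h
      have := H.le_stab _ _ (hle k.2)
      rw [← this] at h'
      exact MulAction.injective (k : G) h')⟩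
  have hinj : Function.Injective f := by
    intro k k' h
    have h' : (k : G) • x = (k' : G) • x := congrArg Subtype.val h
    by_contra hne
    have h3 : ((k : G)⁻¹ * k') • x = x := by
      rw [mul_smul, ← h', inv_smul_smul]
    have h5 : (k : G)⁻¹ * k' ∈ Subgroup.zpowers a :=
      mul_mem (inv_mem k.2) k'.2
    have h4 : (k : G)⁻¹ * k' ≠ 1 := by
      intro h; rw [inv_mul_eq_one] at h; exact hne (Subtype.ext h)
    -- the subgroup generated is everything
    have h6 : a ∈ Subgroup.zpowers ((k : G)⁻¹ * k') := by
      have : Subgroup.zpowers ((k : G)⁻¹ * k') = Subgroup.zpowers a := by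
        refine Subgroup.eq_of_le_of_card_ge (by simpa using h5) (ge_of_eq ?_)
        rw [Nat.card_zpowers, Nat.card_zpowers, H.D_order ha ha1, H.D_order (hle h5) h4]
      rw [this]; exact Subgroup.mem_zpowers a
    exact hx (Fx_zpowers h6 h3)
  have hcard : Nat.card (Subgroup.zpowers a) = Nat.card (N \ {c} : Set L) := by
    rw [Nat.card_zpowers, H.D_order ha ha1, Nat.card_coe_set_eq,
      Set.ncard_sdiff_singleton_of_mem hcN, H.line_ncard hN]; rfl
  have hb := (Nat.bijective_iff_injective_and_card f).2 ⟨hinj, hcard⟩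
  obtain ⟨k, hk⟩ := hb.2 ⟨t, htN, htc⟩
  exact ⟨k, hle k.2, k.2, congrArg Subtype.val hk⟩

end Geo
end ODL3

open scoped MatrixGroups LinearAlgebra.Projectivization

namespace ODL3

set_option linter.unusedSectionVars false

namespace Geo

variable {p : ℕ} [hp : Fact p.Prime] {G : Type*} [Group G] [Finite G] {L : Type*} [Finite L]
  [MulAction G L] {D : L → Subgroup G} {l0 : L} {E : ZMod p × ZMod p → G}

theorem E_nsmul (H : Geo p G L D l0 E) (n : ℕ) (u : ZMod p × ZMod p) : E (n • u) = (E u) ^ n := by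
  induction n with
  | zero => simp [H.E0]
  | succ n ih => rw [succ_nsmul, H.Eadd, ih, pow_succ]

theorem E_mem (H : Geo p G L D l0 E) (u : ZMod p × ZMod p) : E u ∈ D l0 := (H.Erange _).2 ⟨u, rfl⟩

theorem E_comm_smul (H : Geo p G L D l0 E) (u v : ZMod p × ZMod p) (x : L) :
    E u • E v • x = E v • E u • x := by
  rw [← mul_smul, ← mul_smul, ← H.Eadd, ← H.Eadd, add_comm]

theorem E_ne_one (H : Geo p G L D l0 E) {u : ZMod p × ZMod p} (hu : u ≠ 0) : E u ≠ 1 := by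
  intro h; rw [← H.E0] at h; exact hu (H.Einj h)

theorem exists_lam (H : Geo p G L D l0 E) (y : L) (hy : y ≠ l0) :
    ∃ m : ZMod p × ZMod p, m ≠ 0 ∧ ∀ u : ZMod p × ZMod p, m.1 * u.1 + m.2 * u.2 = 0 ↔ E u • y = y := by
  obtain ⟨a, ha, ha1, hay⟩ := H.Dst_exists hy
  obtain ⟨v, rfl⟩ := (H.Erange _).1 ha
  have hv : v ≠ 0 := by rintro rfl; exact ha1 H.E0
  refine ⟨(-v.2, v.1), ?_, fun u => ⟨?_, ?_⟩⟩
  · intro h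
    apply hv
    have h1 := congrArg Prod.fst h
    have h2 := congrArg Prod.snd h
    ext
    · simpa using h2
    · simpa using h1
  · intro h
    have : ∃ c : ZMod p, u = c • v := by
      simp only at h
      by_cases h1 : v.1 = 0
      · have h2 : v.2 ≠ 0 := fun h2 => hv (Prod.ext h1 h2)
        refine ⟨u.2 / v.2, Prod.ext ?_ ?_⟩
        · rw [h1] at h
          have : u.1 = 0 := by
            simpa [h2] using h
          simp [h1, this]
        · simp [h2]
      · refine ⟨u.1 / v.1, Prod.ext ?_ ?_⟩
        · simp [h1]
        · simp only [Prod.smul_snd, smul_eq_mul]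
          field_simp
          linear_combination h
    obtain ⟨c, rfl⟩ := this
    have h2 : c • v = c.val • v := by
      ext <;> simp
    rw [h2, H.E_nsmul]
    exact Fx_zpowers (Subgroup.npow_mem_zpowers _ _) hay
  · intro h
    have := H.Dst_gen hy (mem_Dst.2 ⟨ha, hay⟩) ha1 (mem_Dst.2 ⟨H.E_mem u, h⟩)
    rw [← mem_powers_iff_mem_zpowers] at this
    obtain ⟨n, hn⟩ := this
    simp only at hn
    rw [← H.E_nsmul] at hn
    rw [← H.Einj hn]
    rw [Prod.smul_fst, Prod.smul_snd, nsmul_eq_mul, nsmul_eq_mul]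
    ring

theorem exists_dual (m : ZMod p × ZMod p) (hm : m ≠ 0) :
    ∃ w : ZMod p × ZMod p, m.1 * w.1 + m.2 * w.2 = 1 := by
  by_cases h1 : m.1 = 0
  · have h2 : m.2 ≠ 0 := fun h2 => hm (Prod.ext h1 h2)
    exact ⟨(0, (m.2)⁻¹), by simp [h2]⟩
  · exact ⟨((m.1)⁻¹, 0), by simp [h1]⟩

theorem orbit_inj (H : Geo p G L D l0 E) {O : Set L} (hO : IsLine D O) (h0 : l0 ∉ O)
    {y y' : L} (hy : y ∈ O) (hy' : y' ∈ O) (v : ZMod p × ZMod p) (hv : v ≠ 0)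
    (h : E v • y = y) (h' : E v • y' = y') : y = y' := by
  by_contra hne
  apply h0
  rw [H.line_unique hO ⟨l0, E v, H.E_mem v, H.E_ne_one hv, rfl⟩ hne hy hy' h h']
  exact H.le_stab _ _ (H.E_mem v)

theorem stab_orbit (H : Geo p G L D l0 E) (u v : ZMod p × ZMod p) (y : L) :
    E v • E u • y = E u • y ↔ E v • y = y := by
  rw [H.E_comm_smul]
  exact ⟨fun h => MulAction.injective _ h, fun h => by rw [h]⟩

theorem exists_ne_stab (H : Geo p G L D l0 E) {y : L} (hy : y ≠ l0) : ∃ v, v ≠ 0 ∧ E v • y = y := by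
  obtain ⟨a, ha, ha1, hay⟩ := H.Dst_exists hy
  obtain ⟨v, rfl⟩ := (H.Erange _).1 ha
  exact ⟨v, by rintro rfl; exact ha1 H.E0, hay⟩

theorem orbit_inj' (H : Geo p G L D l0 E) {O : Set L} (hO : IsLine D O) (h0 : l0 ∉ O)
    {y y' : L} (hy : y ∈ O) (hy' : y' ∈ O) (u u' : ZMod p × ZMod p)
    (h : E u • y = E u' • y') : y = y' := by
  obtain ⟨v, hv, hvy⟩ := H.exists_ne_stab (y := y) (fun e => h0 (e ▸ hy))
  refine H.orbit_inj hO h0 hy hy' v hv hvy ?_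
  rw [← H.stab_orbit u', ← h, H.stab_orbit, hvy]

theorem E_diff (H : Geo p G L D l0 E) {u u' : ZMod p × ZMod p} {y : L}
    : E u • y = E u' • y ↔ E (u - u') • y = y := by
  have : u = u' + (u - u') := by abel
  constructor
  · intro h
    rw [this, H.Eadd, mul_smul] at h
    exact MulAction.injective _ h
  · intro h
    nth_rw 1 [this]
    rw [H.Eadd, mul_smul, h]

theorem orbit_surj (H : Geo p G L D l0 E) {O : Set L} (hO : IsLine D O) (h0 : l0 ∉ O)
    (x : L) (hx : x ≠ l0) : ∃ y ∈ O, ∃ u, E u • y = x := by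
  have hne : ∀ y ∈ O, y ≠ l0 := fun y hy e => h0 (e ▸ hy)
  choose m hm hm2 using H.exists_lam
  have hw : ∀ y : O, ∃ w : ZMod p × ZMod p, (m y (hne y y.2)).1 * w.1 + (m y (hne y y.2)).2 * w.2 = 1 :=
    fun y => exists_dual _ (hm _ _)
  choose w hw using hw
  let f : O × ZMod p → ({l0}ᶜ : Set L) := fun q => ⟨E (q.2 • w q.1) • (q.1 : L), fun h => by
    apply hne _ q.1.2
    have h' : E (q.2 • w q.1) • (q.1 : L) = l0 := h
    have h2 : E (q.2 • w q.1) • (q.1 : L) = E (q.2 • w q.1) • l0 := by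
      rw [h', H.le_stab _ _ (H.E_mem _)]
    exact MulAction.injective _ h2⟩
  have hinj : Function.Injective f := by
    rintro ⟨y, s⟩ ⟨y', s'⟩ h
    have h1 : E (s • w y) • (y : L) = E (s' • w y') • (y' : L) := congrArg Subtype.val h
    have h2 : y = y' := Subtype.ext (H.orbit_inj' hO h0 y.2 y'.2 _ _ h1)
    subst h2
    rw [H.E_diff, ← hm2 _ (hne _ y.2)] at h1
    have := hw y
    simp only [Prod.fst_sub, Prod.snd_sub, Prod.smul_fst, Prod.smul_snd, smul_eq_mul] at h1
    have : s - s' = 0 := by linear_combination h1 - (s - s') * this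
    rw [sub_eq_zero.1 this]
  have hcard : Nat.card (O × ZMod p) = Nat.card ({l0}ᶜ : Set L) := by
    rw [Nat.card_prod, Nat.card_zmod, Nat.card_coe_set_eq, Nat.card_coe_set_eq, H.line_ncard hO,
      Set.ncard_compl, Set.ncard_singleton, H.cardL]
    have : p ^ 2 + p + 1 - 1 = p ^ 2 + p := rfl
    rw [this]; ring
  have hb := (Nat.bijective_iff_injective_and_card f).2 ⟨hinj, hcard⟩
  obtain ⟨q, hq⟩ := hb.2 ⟨x, hx⟩
  exact ⟨q.1, q.1.2, _, congrArg Subtype.val hq⟩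

theorem coords (H : Geo p G L D l0 E) : ∃ vec : L → Fin 3 → ZMod p, (∀ x, vec x ≠ 0) ∧
    (∀ x y (c : ZMod p), vec x = c • vec y → x = y) ∧
    (∀ w : Fin 3 → ZMod p, w ≠ 0 → IsLine D {x | w ⬝ᵥ vec x = 0}) := by
  classical
  obtain ⟨O, hO, h0⟩ := H.exists_off_line
  have hne : ∀ y ∈ O, y ≠ l0 := fun y hy e => h0 (e ▸ hy)
  choose m hm hm2 using H.exists_lam
  choose Y hY U hU using H.orbit_surj hO h0
  let vec : L → Fin 3 → ZMod p := fun x => if hx : x = l0 then ![0, 0, 1] else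
    let q := m (Y x hx) (hne _ (hY x hx)); ![q.1, q.2, q.1 * (U x hx).1 + q.2 * (U x hx).2]
  have hv0 : vec l0 = ![0, 0, 1] := by simp [vec]
  have hv : ∀ y (hy : y ∈ O) u, vec (E u • y) = ![(m y (hne y hy)).1, (m y (hne y hy)).2,
      (m y (hne y hy)).1 * u.1 + (m y (hne y hy)).2 * u.2] := by
    intro y hy u
    have hx : E u • y ≠ l0 := by
      intro h'
      apply hne y hy
      have h2 : E u • y = E u • l0 := by
        rw [h', H.le_stab _ _ (H.E_mem _)]
      exact MulAction.injective _ h2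
    have e : Y (E u • y) hx = y := H.orbit_inj' hO h0 (hY _ _) hy _ _ (hU (E u • y) hx)
    have e2 := hU (E u • y) hx
    simp only [vec, hx, dif_neg, not_false_iff]
    have key : ∀ y' (hy' : y' ≠ l0), y' = y → m y' hy' = m y (hne y hy) := by
      rintro y' hy' rfl; rfl
    rw [key _ _ e]
    rw [e] at e2
    rw [H.E_diff, ← hm2 _ (hne _ hy)] at e2
    congr 3
    simp only [Prod.fst_sub, Prod.snd_sub] at e2
    linear_combination e2
  have hcase : ∀ x, x = l0 ∨ ∃ y, ∃ hy : y ∈ O, ∃ u, x = E u • y := by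
    intro x
    by_cases hx : x = l0
    · exact Or.inl hx
    · exact Or.inr ⟨Y x hx, hY x hx, U x hx, (hU x hx).symm⟩
  have hm' : ∀ y hy, (m y hy).1 = 0 → (m y hy).2 = 0 → False := fun y hy h1 h2 =>
    hm y hy (Prod.ext h1 h2)
  refine ⟨vec, ?_, ?_, ?_⟩
  · intro x h
    rcases hcase x with rfl | ⟨y, hy, u, rfl⟩
    · rw [hv0] at h
      have := congrFun h 2
      simp at this
    · rw [hv y hy] at h
      have h1 := congrFun h 0
      have h2 := congrFun h 1
      exact hm' _ _ (by simpa using h1) (by simpa using h2)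
  · intro x x' c h
    have g0 := congrFun h 0
    have g1 := congrFun h 1
    have g2 := congrFun h 2
    simp only [Pi.smul_apply, smul_eq_mul] at g0 g1 g2
    rcases hcase x with rfl | ⟨y, hy, u, rfl⟩ <;> rcases hcase x' with rfl | ⟨y', hy', u', rfl⟩
    · rfl
    · exfalso
      rw [hv0, hv y' hy'] at g0 g1 g2
      simp at g0 g1 g2
      rcases g0 with g0 | g0
      · simp [g0] at g2
      · rcases g1 with g1 | g1
        · simp [g1] at g2
        · exact hm' _ _ g0 g1
    · exfalso
      rw [hv0, hv y hy] at g0 g1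
      simp at g0 g1
      exact hm' _ _ g0 g1
    · rw [hv y hy, hv y' hy'] at g0 g1 g2
      simp at g0 g1 g2
      have hyy : y = y' := by
        obtain ⟨v, hv1, hvy⟩ := H.exists_ne_stab (y := y') (hne _ hy')
        refine H.orbit_inj hO h0 hy hy' v hv1 ?_ hvy
        rw [← hm2 _ (hne _ hy'), ] at hvy
        rw [← hm2 _ (hne _ hy), g0, g1]
        linear_combination c * hvy
      subst hyy
      have hc : c = 1 := by
        by_contra hc
        have hc' : c - 1 ≠ 0 := sub_ne_zero.2 hc
        apply hm' y (hne _ hy)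
        · apply mul_left_cancel₀ hc'
          linear_combination -g0
        · apply mul_left_cancel₀ hc'
          linear_combination -g1
      subst hc
      rw [H.E_diff, ← hm2 _ (hne _ hy)]
      simp only [Prod.fst_sub, Prod.snd_sub]
      linear_combination g2
  · intro w hw
    by_cases hr : w 2 = 0
    · have hw' : (w 0, w 1) ≠ (0 : ZMod p × ZMod p) := by
        intro h
        apply hw
        ext i
        fin_cases i
        · exact congrArg Prod.fst h
        · exact congrArg Prod.snd h
        · exact hr
      refine ⟨l0, E (w 0, w 1), H.E_mem _, H.E_ne_one hw', ?_⟩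
      ext x
      simp only [Set.mem_ofPred_eq, Fx]
      rcases hcase x with rfl | ⟨y, hy, u, rfl⟩
      · simp [hv0, dotProduct, Fin.sum_univ_three, hr, H.le_stab _ _ (H.E_mem _)]
      · rw [H.stab_orbit, ← hm2 _ (hne _ hy), hv y hy]
        simp [dotProduct, Fin.sum_univ_three, hr, mul_comm]
    · have := H.line_image hO (E (-(w 0) / w 2, -(w 1) / w 2))
      convert this using 1
      ext x
      simp only [Set.mem_ofPred_eq, Set.mem_image]
      rcases hcase x with rfl | ⟨y, hy, u, rfl⟩
      · simp only [hv0, dotProduct, Fin.sum_univ_three]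
        simp only [Matrix.cons_val_zero, Matrix.cons_val_one, Matrix.cons_val, mul_zero, zero_add,
          mul_one, hr, false_iff]
        rintro ⟨y, hy, h⟩
        rw [← H.le_stab _ _ (H.E_mem (-(w 0) / w 2, -(w 1) / w 2))] at h
        exact hne y hy (MulAction.injective _ h)
      · rw [hv y hy]
        have : (∃ x ∈ O, E (-w 0 / w 2, -w 1 / w 2) • x = E u • y) ↔
            E (-w 0 / w 2, -w 1 / w 2) • y = E u • y := by
          constructor
          · rintro ⟨y', hy', h⟩
            have := H.orbit_inj' hO h0 hy' hy _ _ h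
            rwa [this] at h
          · intro h; exact ⟨y, hy, h⟩
        rw [this, H.E_diff, ← hm2 _ (hne _ hy)]
        simp only [dotProduct, Fin.sum_univ_three, Matrix.cons_val_zero, Matrix.cons_val_one,
          Matrix.cons_val, Prod.fst_sub, Prod.snd_sub]
        field_simp
        constructor
        · intro h; linear_combination -h
        · intro h; linear_combination -h

end Geo
end ODL3

open scoped MatrixGroups LinearAlgebra.Projectivization

namespace ODL3

set_option linter.unusedSectionVars false

theorem exists_orth {F : Type*} [Field F] (v1 v2 : Fin 3 → F) :
    ∃ w : Fin 3 → F, w ≠ 0 ∧ w ⬝ᵥ v1 = 0 ∧ w ⬝ᵥ v2 = 0 := by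
  let M : Matrix (Fin 3) (Fin 3) F := ![v1, v2, 0]
  have h : M.det = 0 := Matrix.det_eq_zero_of_row_eq_zero 2 (fun j => rfl)
  obtain ⟨w, hw, hM⟩ := Matrix.exists_mulVec_eq_zero_iff.2 h
  refine ⟨w, hw, ?_, ?_⟩
  · rw [dotProduct_comm]; exact congrFun hM 0
  · rw [dotProduct_comm]; exact congrFun hM 1

namespace Geo

variable {p : ℕ} [hp : Fact p.Prime] {G : Type*} [Group G] [Finite G] {L : Type*} [Finite L]
  [MulAction G L] {D : L → Subgroup G} {l0 : L} {E : ZMod p × ZMod p → G}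

theorem rigid0 (H : Geo p G L D l0 E)
    (meet : ∀ A B, IsLine D A → IsLine D B → ∃ x, x ∈ A ∧ x ∈ B)
    (f g : L → L) (hfi : Function.Injective f)
    (hf : ∀ A, IsLine D A → IsLine D (f '' A)) (hg : ∀ A, IsLine D A → IsLine D (g '' A))
    {M : Set L} (hM : IsLine D M) {c : L} (hc : c ∈ M) (hfM : ∀ x ∈ M, f x = x)
    (hgM : ∀ x ∈ M, g x = x) (hfc : ∀ A, IsLine D A → c ∈ A → ∀ x ∈ A, f x ∈ A)
    (hgc : ∀ A, IsLine D A → c ∈ A → ∀ x ∈ A, g x ∈ A) {x0 : L} (hx0 : x0 ∉ M)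
    (h0 : f x0 = g x0) {N : Set L} (hN : IsLine D N) (hcN : c ∈ N) (hx0N : x0 ∈ N)
    {x : L} (hxN : x ∉ N) : f x = g x := by
  have hxx0 : x ≠ x0 := fun h => hxN (h ▸ hx0N)
  have hxc : x ≠ c := fun h => hxN (h ▸ hcN)
  obtain ⟨A, hA, hxA, hx0A⟩ := H.line_exists hxx0
  obtain ⟨z, hzA, hzM⟩ := meet A M hA hM
  obtain ⟨B, hB, hxB, hcB⟩ := H.line_exists hxc
  have hzx0 : z ≠ x0 := fun h => hx0 (h ▸ hzM)
  have e1 : f '' A = g '' A := by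
    refine H.line_unique (hf A hA) (hg A hA) (x := z) (y := f x0) ?_ ⟨z, hzA, hfM z hzM⟩
      ⟨x0, hx0A, rfl⟩ ⟨z, hzA, hgM z hzM⟩ ⟨x0, hx0A, h0.symm⟩
    intro h
    apply hzx0
    apply hfi
    rw [hfM z hzM, h]
  by_contra hne
  have e2 : f '' A = B := by
    refine H.line_unique (hf A hA) hB hne ⟨x, hxA, rfl⟩ ?_ (hfc B hB hcB x hxB) (hgc B hB hcB x hxB)
    rw [e1]; exact ⟨x, hxA, rfl⟩
  have hcA : c ∈ A := by
    rw [← e2] at hcB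
    obtain ⟨y, hy, hyc⟩ := hcB
    have : y = c := hfi (hyc.trans (hfM c hc).symm)
    exact this ▸ hy
  apply hxN
  rw [H.line_unique hN hA (x := c) (y := x0) (fun h => hx0 (h ▸ hc)) hcN hx0N hcA hx0A]
  exact hxA

theorem rigid (H : Geo p G L D l0 E)
    (meet : ∀ A B, IsLine D A → IsLine D B → ∃ x, x ∈ A ∧ x ∈ B)
    (f g : L → L) (hfi : Function.Injective f)
    (hf : ∀ A, IsLine D A → IsLine D (f '' A)) (hg : ∀ A, IsLine D A → IsLine D (g '' A))
    {M : Set L} (hM : IsLine D M) {c : L} (hc : c ∈ M) (hfM : ∀ x ∈ M, f x = x)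
    (hgM : ∀ x ∈ M, g x = x) (hfc : ∀ A, IsLine D A → c ∈ A → ∀ x ∈ A, f x ∈ A)
    (hgc : ∀ A, IsLine D A → c ∈ A → ∀ x ∈ A, g x ∈ A) {x0 : L} (hx0 : x0 ∉ M)
    (h0 : f x0 = g x0) (x : L) : f x = g x := by
  by_cases hxM : x ∈ M
  · rw [hfM x hxM, hgM x hxM]
  obtain ⟨N, hN, hcN, hx0N⟩ := H.line_exists (x := c) (y := x0) (fun h => hx0 (h ▸ hc))
  by_cases hxN : x ∈ N
  · obtain ⟨x1, hx1M, hx1N⟩ := H.exists_not_mem hM hN ⟨c, hc, hcN⟩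
    have h1 := H.rigid0 meet f g hfi hf hg hM hc hfM hgM hfc hgc hx0 h0 hN hcN hx0N hx1N
    obtain ⟨N1, hN1, hcN1, hx1N1⟩ := H.line_exists (x := c) (y := x1) (fun h => hx1M (h ▸ hc))
    refine H.rigid0 meet f g hfi hf hg hM hc hfM hgM hfc hgc hx1M h1 hN1 hcN1 hx1N1 ?_
    intro hx
    apply hx1N
    rw [H.line_unique hN hN1 (x := c) (y := x) (fun h => hxM (h ▸ hc)) hcN hxN hcN1 hx]
    exact hx1N1
  · exact H.rigid0 meet f g hfi hf hg hM hc hfM hgM hfc hgc hx0 h0 hN hcN hx0N hxN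

set_option maxHeartbeats 1000000 in
theorem final (H : Geo p G L D l0 E) (hcard : Nat.card G ≤ Nat.card PSL(3, ZMod p)) :
    Nonempty (G ≃* PSL(3, ZMod p)) := by
  obtain ⟨vec, hv0, hvi, hvl⟩ := H.coords
  let ph : L → ℙ (ZMod p) (Fin 3 → ZMod p) := fun x => Projectivization.mk _ (vec x) (hv0 x)
  have hphi : Function.Injective ph := by
    intro x y h
    obtain ⟨c, hc⟩ := (Projectivization.mk_eq_mk_iff' _ _ _ _ _).1 h
    exact hvi x y c hc.symm
  have hphc : Nat.card L = Nat.card (ℙ (ZMod p) (Fin 3 → ZMod p)) := by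
    rw [Projectivization.card_of_finrank (ZMod p) (Fin 3 → ZMod p) (n := 3) (by simp), H.cardL]
    simp [Finset.sum_range_succ]
    ring
  have hb := (Nat.bijective_iff_injective_and_card ph).2 ⟨hphi, hphc⟩
  let φ : L ≃ ℙ (ZMod p) (Fin 3 → ZMod p) := Equiv.ofBijective ph hb
  have hφ : ∀ x, φ x = Projectivization.mk _ (vec x) (hv0 x) := fun x => rfl
  have hsurj : ∀ v : Fin 3 → ZMod p, v ≠ 0 → ∃ x, ∃ k : ZMod p, k ≠ 0 ∧ vec x = k • v := by
    intro v hv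
    obtain ⟨x, hx⟩ := hb.2 (Projectivization.mk _ v hv)
    obtain ⟨k, hk⟩ := (Projectivization.mk_eq_mk_iff' _ _ _ _ _).1 hx
    refine ⟨x, k, ?_, hk.symm⟩
    rintro rfl
    exact hv0 x (by rw [← hk, zero_smul])
  have hform : ∀ M, IsLine D M → ∃ w : Fin 3 → ZMod p, w ≠ 0 ∧ M = {x | w ⬝ᵥ vec x = 0} := by
    intro M hM
    have h1 : 1 < M.ncard := by rw [H.line_ncard hM]; have := hp.out.pos; omega
    obtain ⟨x, y, hx, hy, hxy⟩ := (Set.one_lt_ncard_iff).1 h1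
    obtain ⟨w, hw, hwx, hwy⟩ := exists_orth (vec x) (vec y)
    exact ⟨w, hw, H.line_unique hM (hvl w hw) hxy hx hy hwx hwy⟩
  have meet : ∀ A B, IsLine D A → IsLine D B → ∃ x, x ∈ A ∧ x ∈ B := by
    intro A B hA hB
    obtain ⟨w, hw, rfl⟩ := hform A hA
    obtain ⟨w', hw', rfl⟩ := hform B hB
    obtain ⟨v, hv, h1, h2⟩ := exists_orth w w'
    obtain ⟨x, k, hk, hx⟩ := hsurj v hv
    refine ⟨x, ?_, ?_⟩
    · simp only [Set.mem_ofPred_eq, hx, dotProduct_smul, dotProduct_comm w v, h1, smul_zero]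
    · simp only [Set.mem_ofPred_eq, hx, dotProduct_smul, dotProduct_comm w' v, h2, smul_zero]
  refine psl_ident p G φ hcard ?_
  intro i j hij s
  set τ : Matrix.SpecialLinearGroup (Fin 3) (ZMod p) :=
    Matrix.SpecialLinearGroup.transvection hij s with hτ
  have hτv : ∀ v : Fin 3 → ZMod p, τ • v = v + (s * v j) • Pi.single i 1 := by
    intro v
    have : τ • v = (τ : Matrix (Fin 3) (Fin 3) (ZMod p)).mulVec v := rfl
    rw [this, hτ, Matrix.SpecialLinearGroup.transvection_coe, Matrix.add_mulVec, Matrix.one_mulVec]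
    congr 1
    rw [Matrix.single_mulVec]
    ext k
    by_cases hk : k = i
    · subst hk; simp
    · simp [hk]
  let T : L → L := fun x => φ.symm (τ • φ x)
  have hT : ∀ x, ∃ c : ZMod p, c ≠ 0 ∧ vec (T x) = c • (vec x + (s * vec x j) • Pi.single i 1) := by
    intro x
    have h : φ (T x) = τ • φ x := φ.apply_symm_apply _
    rw [hφ, hφ, Projectivization.smul_mk] at h
    obtain ⟨c, hc⟩ := (Projectivization.mk_eq_mk_iff' _ _ _ _ _).1 h
    refine ⟨c, ?_, ?_⟩
    · rintro rfl
      exact hv0 (T x) (by rw [← hc, zero_smul])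
    · rw [← hc, hτv]
  have hTinj : Function.Injective T := by
    intro x y h
    have := φ.symm.injective h
    exact φ.injective (MulAction.injective τ this)
  have hTsurj : Function.Surjective T := Finite.surjective_of_injective hTinj
  have hTM : ∀ x, vec x j = 0 → T x = x := by
    intro x hx
    obtain ⟨c, hc, h⟩ := hT x
    rw [hx] at h
    exact hvi _ _ c (by simpa using h)
  have hTline : ∀ A, IsLine D A → IsLine D (T '' A) := by
    intro A hA
    obtain ⟨w, hw, rfl⟩ := hform A hA
    set w' : Fin 3 → ZMod p := w - (s * w i) • Pi.single j 1 with hw'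
    have hw'0 : w' ≠ 0 := by
      intro h
      have h1 := congrFun h i
      simp [hw', hij] at h1
      rw [hw', h1] at h
      simp at h
      exact hw h
    have key : ∀ x, w' ⬝ᵥ vec (T x) = 0 ↔ w ⬝ᵥ vec x = 0 := by
      intro x
      obtain ⟨c, hc, h⟩ := hT x
      rw [h, dotProduct_smul, smul_eq_mul, mul_eq_zero, or_iff_right hc]
      have : w' ⬝ᵥ (vec x + (s * vec x j) • Pi.single i 1) = w ⬝ᵥ vec x := by
        simp only [hw', dotProduct_add, dotProduct_smul, sub_dotProduct, smul_dotProduct,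
          dotProduct_single_one, single_one_dotProduct, smul_eq_mul]
        have e : (Pi.single j 1 : Fin 3 → ZMod p) i = 0 := by simp [hij]
        simp [e, hij]
        ring
      rw [this]
    have : T '' {x | w ⬝ᵥ vec x = 0} = {x | w' ⬝ᵥ vec x = 0} := by
      ext y
      simp only [Set.mem_image, Set.mem_ofPred_eq]
      constructor
      · rintro ⟨x, hx, rfl⟩; exact (key x).2 hx
      · intro hy
        obtain ⟨x, rfl⟩ := hTsurj y
        exact ⟨x, (key x).1 hy, rfl⟩
    rw [this]
    exact hvl w' hw'0
  obtain ⟨c, kc, hkc, hc⟩ := hsurj (Pi.single i 1) (by simp)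
  obtain ⟨x0, k0, hk0, hx0⟩ := hsurj (Pi.single j 1) (by simp)
  have hM : IsLine D {x | (Pi.single j 1 : Fin 3 → ZMod p) ⬝ᵥ vec x = 0} := hvl _ (by simp)
  have hMmem : ∀ x, x ∈ {x | (Pi.single j 1 : Fin 3 → ZMod p) ⬝ᵥ vec x = 0} ↔ vec x j = 0 := by
    intro x; simp
  set M := {x | (Pi.single j 1 : Fin 3 → ZMod p) ⬝ᵥ vec x = 0} with hMdef
  have hcM : c ∈ M := by rw [hMmem, hc]; simp [hij.symm]
  have hx0M : x0 ∉ M := by rw [hMmem, hx0]; simp [hk0]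
  have hTc : ∀ A, IsLine D A → c ∈ A → ∀ x ∈ A, T x ∈ A := by
    intro A hA hcA x hx
    obtain ⟨w, hw, rfl⟩ := hform A hA
    simp only [Set.mem_ofPred_eq] at hcA hx ⊢
    rw [hc] at hcA
    have hwi : w i = 0 := by simpa [hkc] using hcA
    obtain ⟨c', hc', h⟩ := hT x
    rw [h]
    simp [dotProduct_add, hx, hwi]
  obtain ⟨a, ha, ha1, haM⟩ := H.line_at hM hcM
  have hx0c : c ≠ x0 := fun h => hx0M (h ▸ hcM)
  obtain ⟨N, hN, hcN, hx0N⟩ := H.line_exists hx0c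
  have hax0 : a • x0 ≠ x0 := by
    intro h; apply hx0M; rw [haM]; exact h
  obtain ⟨g, hgD, hga, hgx⟩ := H.move hN ha ha1 hax0 hcN hx0N (hTc N hN hcN x0 hx0N) (by
    intro h
    have : T x0 = T c := by rw [h, hTM c ((hMmem c).1 hcM)]
    exact hx0c (hTinj this).symm)
  refine ⟨g, fun x => ?_⟩
  have := H.rigid meet (fun x => g • x) T (MulAction.injective g) (fun A hA => H.line_image hA g)
    hTline hM hcM (fun x hx => by rw [haM] at hx; exact Fx_zpowers hga hx)
    (fun x hx => hTM x ((hMmem x).1 hx)) (fun A hA hcA x hx => H.line_central hA hcA hgD hx)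
    hTc hx0M hgx x
  change g • x = T x at this
  rw [this]
  exact φ.apply_symm_apply _

end Geo
end ODL3


namespace ODL3

set_option linter.unusedSectionVars false

open Subgroup

section basics
variable {G : Type*} [Group G]

/-- conjugation action of a subgroup on a subgroup that it normalizes. -/
@[reducible] def conjActOn (H K : Subgroup G) (h : H ≤ normalizer (K : Set G)) : MulAction H K where
  smul g k := ⟨g * k * (g : G)⁻¹, (mem_normalizer_iff.1 (h g.2) k).1 k.2⟩
  one_smul k := Subtype.ext (show (1 : G) * k * (1 : G)⁻¹ = k by simp)
  mul_smul g g' k := Subtype.ext (show (g * g' : G) * k * (g * g' : G)⁻¹ = g * (g' * k * (g' : G)⁻¹) * (g : G)⁻¹ by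
    group)

variable [Finite G] {p : ℕ} [hp : Fact p.Prime]

theorem exists_central {S D : Subgroup G} (hS : IsPGroup p S) (hSD : S ≤ normalizer (D : Set G))
    (hD : p ∣ Nat.card D) : ∃ z ∈ D, orderOf z = p ∧ ∀ s ∈ S, s * z = z * s := by
  let act := conjActOn S D hSD
  have h1 := hS.card_modEq_card_fixedPoints D
  have e : Nat.card (MulAction.fixedPoints S D) = Nat.card (D ⊓ centralizer (S : Set G) : Subgroup G) := by
    refine Nat.card_congr ⟨fun x => ⟨x.1, x.1.2, ?_⟩, fun x => ⟨⟨x.1, x.2.1⟩, ?_⟩, fun x => rfl, fun x => rfl⟩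
    · refine mem_centralizer_iff.2 ?_
      intro s hs
      have : s * x.1 * s⁻¹ = x.1 := congrArg Subtype.val (x.2 ⟨s, hs⟩)
      exact mul_inv_eq_iff_eq_mul.1 this
    · intro s
      apply Subtype.ext
      change (s : G) * x.1 * (s : G)⁻¹ = x.1
      rw [mul_inv_eq_iff_eq_mul]
      exact mem_centralizer_iff.1 x.2.2 s s.2
  rw [e] at h1
  have h2 : p ∣ Nat.card (D ⊓ centralizer (S : Set G) : Subgroup G) :=
    (Nat.modEq_zero_iff_dvd.1 (h1.symm.trans (Nat.modEq_zero_iff_dvd.2 hD)))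
  obtain ⟨z, hz⟩ := exists_prime_orderOf_dvd_card' p h2
  refine ⟨z, z.2.1, by rw [← hz]; simp, fun s hs => mem_centralizer_iff.1 z.2.2 s hs⟩

theorem comm_mem {S : Subgroup G} (hS : Nat.card S = p ^ 3) {z : G} (hz : z ∈ S) (ho : orderOf z = p)
    (hc : ∀ s ∈ S, s * z = z * s) {a b : G} (ha : a ∈ S) (hb : b ∈ S) :
    ∃ k : ℕ, a * b * a⁻¹ = z ^ k * b := by
  let Z : Subgroup S := zpowers (⟨z, hz⟩ : S)
  have hZn : Z.Normal := by
    constructor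
    intro n hn g
    obtain ⟨k, rfl⟩ := mem_zpowers_iff.1 hn
    have hcg : Commute g ⟨z, hz⟩ := Subtype.ext (hc g g.2)
    have : g * (⟨z, hz⟩ : S) ^ k * g⁻¹ = (⟨z, hz⟩ : S) ^ k := by
      rw [mul_inv_eq_iff_eq_mul]
      exact hcg.zpow_right k
    rw [this]; exact hn
  have hq : Nat.card (S ⧸ Z) = p ^ 2 := by
    have h1 := card_eq_card_quotient_mul_card_subgroup Z
    have h2 : Nat.card Z = p := by
      rw [Nat.card_zpowers, ← ho]; exact (orderOf_mk z hz)
    rw [h2, hS] at h1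
    have : p ^ 3 = p ^ 2 * p := by ring
    rw [this] at h1
    exact (Nat.eq_of_mul_eq_mul_right hp.out.pos h1).symm
  have h3 := IsPGroup.commutative_of_card_eq_prime_sq hq (QuotientGroup.mk (⟨b, hb⟩ : S)) (QuotientGroup.mk (⟨a, ha⟩ : S))
  rw [← QuotientGroup.mk_mul, ← QuotientGroup.mk_mul, QuotientGroup.eq] at h3
  rw [← mem_powers_iff_mem_zpowers] at h3
  obtain ⟨k, hk⟩ := h3
  have hk' : z ^ k = (b * a)⁻¹ * (a * b) := congrArg Subtype.val hk
  refine ⟨k, ?_⟩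
  have h4 : a * b = (b * a) * z ^ k := by rw [hk']; group
  have h5 : (b * a) * z ^ k = z ^ k * (b * a) := by
    have : Commute (b * a) z := hc _ (mul_mem hb ha)
    exact this.pow_right k
  rw [h4, h5]; group

theorem sylow_conj_in {K : Subgroup G} {S T : Sylow p G} (hS : (S : Subgroup G) ≤ K)
    (hT : (T : Subgroup G) ≤ K) : ∃ k ∈ K, k • S = T := by
  obtain ⟨k, hk⟩ := MulAction.exists_smul_eq K (S.subtype hS) (T.subtype hT)
  refine ⟨k, k.2, ?_⟩
  apply Sylow.subtype_injective (hP := ?_) (hQ := ?_) (N := K)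
  · rw [← hk]
    exact (Sylow.smul_subtype hS k).symm
  · exact hT

theorem sylow_eq_of_le_normalizer {S T : Sylow p G} (h : (T : Subgroup G) ≤ normalizer (S : Set G)) :
    T = S := by
  have h1 := T.isPGroup'.inf_normalizer_sylow S
  rw [inf_eq_left.2 h] at h1
  have h2 : (T : Subgroup G) ≤ S := by rw [h1]; exact inf_le_right
  exact (Sylow.ext (T.is_maximal' S.isPGroup' h2)).symm

theorem mem_smul_sylow {S : Sylow p G} {g x : G} : x ∈ ((g • S : Sylow p G) : Subgroup G) ↔ g⁻¹ * x * g ∈ S := by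
  rw [Sylow.coe_subgroup_smul, Subgroup.mem_pointwise_smul_iff_inv_smul_mem]
  simp [MulAut.smul_def, MulAut.conj_inv_apply]
  rfl

theorem mem_norm_of {K : Subgroup G} {x : G} (h : ∀ k ∈ K, x * k * x⁻¹ ∈ K) : x ∈ normalizer (K : Set G) :=
  mem_normalizer_fintype h

/-- A subgroup of order `p^2` of a group of order `p^3` is normal. -/
theorem le_normalizer_sq {S D : Subgroup G} (hS : Nat.card S = p ^ 3) (hD : Nat.card D = p ^ 2)
    (hDS : D ≤ S) : S ≤ normalizer (D : Set G) := by
  rw [← normal_subgroupOf_iff_le_normalizer hDS]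
  apply Subgroup.normal_of_index_eq_minFac_card
  rw [hS, Nat.pow_minFac (by norm_num), hp.out.minFac_eq]
  have h1 : Nat.card (D.subgroupOf S) = p ^ 2 := by
    rw [← hD]; exact Nat.card_congr (subgroupOfEquivOfLe hDS).toEquiv
  have h2 := Subgroup.card_mul_index (D.subgroupOf S)
  rw [h1, hS] at h2
  have : p ^ 3 = p ^ 2 * p := by ring
  rw [this] at h2
  exact Nat.eq_of_mul_eq_mul_left (pow_pos hp.out.pos _) h2

end basics
end ODL3


namespace ODL3

set_option linter.unusedSectionVars false

open Subgroup

section loc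
variable {G : Type*} [Group G] [Finite G] {p : ℕ} [hp : Fact p.Prime]

/-- `g` acts by conjugation on the image of `E` through the matrix `a b c d`. -/
def Act (E : ZMod p × ZMod p → G) (g : G) (a b c d : ZMod p) : Prop :=
  ∀ x y, g * E (x, y) * g⁻¹ = E (a * x + b * y, c * x + d * y)

theorem Act.mul {E : ZMod p × ZMod p → G} {g g' : G} {a b c d a' b' c' d' : ZMod p}
    (h : Act E g a b c d) (h' : Act E g' a' b' c' d') :
    Act E (g * g') (a * a' + b * c') (a * b' + b * d') (c * a' + d * c') (c * b' + d * d') := by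
  intro x y
  have : g * g' * E (x, y) * (g * g')⁻¹ = g * (g' * E (x, y) * g'⁻¹) * g⁻¹ := by group
  rw [this, h', h]
  congr 2 <;> ring

theorem Act.congr {E : ZMod p × ZMod p → G} {g : G} {a b c d a' b' c' d' : ZMod p}
    (h : Act E g a b c d) (ha : a = a') (hb : b = b') (hc : c = c') (hd : d = d') :
    Act E g a' b' c' d' := by
  subst ha hb hc hd; exact h

theorem Act.one {E : ZMod p × ZMod p → G} : Act E (1 : G) 1 0 0 1 := by
  intro x y; simp

theorem Act.uniq {E : ZMod p × ZMod p → G} (hE : Function.Injective E) {g : G} {a b c d a' b' c' d' : ZMod p}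
    (h : Act E g a b c d) (h' : Act E g a' b' c' d') : a = a' ∧ b = b' ∧ c = c' ∧ d = d' := by
  have h1 := hE ((h 1 0).symm.trans (h' 1 0))
  have h2 := hE ((h 0 1).symm.trans (h' 0 1))
  simp [Prod.ext_iff] at h1 h2
  tauto

theorem Act.upper_pow {E : ZMod p × ZMod p → G} {g : G} {k : ZMod p}
    (h : Act E g 1 k 0 1) (n : ℕ) : Act E (g ^ n) 1 (n * k) 0 1 := by
  induction n with
  | zero =>
    rw [pow_zero]
    exact Act.one.congr rfl (by simp) rfl rfl
  | succ n ih =>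
    rw [pow_succ]
    exact (ih.mul h).congr (by ring) (by push_cast; ring) (by ring) (by ring)

theorem Act.lower_pow {E : ZMod p × ZMod p → G} {g : G} {k : ZMod p}
    (h : Act E g 1 0 k 1) (n : ℕ) : Act E (g ^ n) 1 0 (n * k) 1 := by
  induction n with
  | zero =>
    rw [pow_zero]
    exact Act.one.congr rfl rfl (by simp) rfl
  | succ n ih =>
    rw [pow_succ]
    exact (ih.mul h).congr (by ring) (by ring) (by push_cast; ring) (by ring)

theorem Act.diag_pow {E : ZMod p × ZMod p → G} {g : G} {t u : ZMod p}
    (h : Act E g t 0 0 u) (n : ℕ) : Act E (g ^ n) (t ^ n) 0 0 (u ^ n) := by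
  induction n with
  | zero =>
    rw [pow_zero]
    exact Act.one.congr (by simp) rfl rfl (by simp)
  | succ n ih =>
    rw [pow_succ]
    exact (ih.mul h).congr (by ring) (by ring) (by ring) (by ring)

/-- Local structure of two Sylow subgroups meeting in `D`. -/
structure Loc (p : ℕ) [Fact p.Prime] {G : Type*} [Group G] (D : Subgroup G) (S T : Sylow p G)
    (E : ZMod p × ZMod p → G) : Prop where
  add : ∀ u v, E (u + v) = E u * E v
  inj : Function.Injective E
  range : ∀ g, g ∈ D ↔ ∃ u, E u = g
  leS : D ≤ S
  leT : D ≤ T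
  cardS : Nat.card S = p ^ 3
  actS : ∀ s ∈ S, ∃ k, Act E s 1 k 0 1
  exS : ∃ s ∈ S, ∃ k, k ≠ 0 ∧ Act E s 1 k 0 1
  exT : ∃ s ∈ T, ∃ k, k ≠ 0 ∧ Act E s 1 0 k 1
  fix : ∀ S' : Sylow p G, D ≤ S' → (∀ s ∈ S', s * E (1, 0) = E (1, 0) * s) → S' = S

theorem pow_val_add {z : G} (hz : orderOf z = p) (x y : ZMod p) :
    z ^ (x + y).val = z ^ x.val * z ^ y.val := by
  rw [ZMod.val_add, ← pow_add, ← pow_mod_orderOf z (x.val + y.val), hz]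

theorem pow_val_natCast {z : G} (hz : orderOf z = p) (k : ℕ) :
    z ^ (k : ZMod p).val = z ^ k := by
  rw [ZMod.val_natCast, ← hz, pow_mod_orderOf]

theorem not_le_centralizer {D : Subgroup G} {S T : Sylow p G} 
    (hcard : ∀ S : Sylow p G, Nat.card S = p ^ 3) (hD : Nat.card D = p ^ 2)
    (hS : D ≤ S) (hT : D ≤ T) (hST : S ≠ T)
    (hX : ∀ S' : Sylow p G, D ≤ S' → centralizer (D : Set G) ≤ normalizer (S' : Set G)) :
    ∃ s ∈ S, ∃ d ∈ D, s * d ≠ d * s := by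
  by_contra hcon
  push Not at hcon
  have hSN := le_normalizer_sq (hcard S) hD hS
  have hTN := le_normalizer_sq (hcard T) hD hT
  obtain ⟨n, hn, hnS⟩ := sylow_conj_in hSN hTN
  apply hST
  symm
  apply sylow_eq_of_le_normalizer
  refine le_trans ?_ (hX S hS)
  intro τ hτ
  rw [← hnS] at hτ
  have hτ' := mem_smul_sylow.1 hτ
  refine mem_centralizer_iff.2 ?_
  intro d hd
  have hd' : n⁻¹ * d * n ∈ D := by
    have := (mem_normalizer_iff.1 (inv_mem hn) d).1 hd
    simpa using this
  have h1 := hcon _ hτ' _ hd'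
  have h2 : n * (n⁻¹ * τ * n * (n⁻¹ * d * n)) * n⁻¹ = n * (n⁻¹ * d * n * (n⁻¹ * τ * n)) * n⁻¹ := by rw [h1]
  have e1 : n * (n⁻¹ * τ * n * (n⁻¹ * d * n)) * n⁻¹ = τ * d := by group
  have e2 : n * (n⁻¹ * d * n * (n⁻¹ * τ * n)) * n⁻¹ = d * τ := by group
  rw [e1, e2] at h2
  exact h2.symm

/-- building the coordinates on `D` -/
theorem coord {D : Subgroup G} (hD : Nat.card D = p ^ 2) {z w : G} (hz : z ∈ D) (hw : w ∈ D)
    (oz : orderOf z = p) (ow : orderOf w = p) (hzw : ∀ k : ℕ, w ≠ z ^ k) :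
    ∃ E : ZMod p × ZMod p → G, (∀ x y, E (x, y) = z ^ x.val * w ^ y.val) ∧
      (∀ u v, E (u + v) = E u * E v) ∧ Function.Injective E ∧ (∀ g, g ∈ D ↔ ∃ u, E u = g) := by
  have hcomm : ∀ a ∈ D, ∀ b ∈ D, a * b = b * a := by
    intro a ha b hb
    have := IsPGroup.commutative_of_card_eq_prime_sq hD ⟨a, ha⟩ ⟨b, hb⟩
    exact congrArg Subtype.val this
  let E : ZMod p × ZMod p → G := fun u => z ^ u.1.val * w ^ u.2.val
  have hadd : ∀ u v, E (u + v) = E u * E v := by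
    intro u v
    change z ^ (u.1 + v.1).val * w ^ (u.2 + v.2).val = z ^ u.1.val * w ^ u.2.val * (z ^ v.1.val * w ^ v.2.val)
    rw [pow_val_add oz, pow_val_add ow]
    have := hcomm _ (pow_mem hz v.1.val) _ (pow_mem hw u.2.val)
    rw [mul_assoc, mul_assoc, ← mul_assoc (z ^ v.1.val), this]
    group
  have hE0 : E 0 = 1 := by simp [E]
  have hneg : ∀ u, E (-u) = (E u)⁻¹ := by
    intro u
    rw [eq_inv_iff_mul_eq_one, ← hadd, neg_add_cancel, hE0]
  have hker : ∀ u, E u = 1 → u = 0 := by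
    rintro ⟨x, y⟩ hu
    have hy : y = 0 := by
      by_contra hy
      have h1 : w ^ y.val = z ^ (-x).val := by
        have h2 : z ^ (-x).val * z ^ x.val = 1 := by rw [← pow_val_add oz]; simp
        have h3 : z ^ x.val * w ^ y.val = 1 := hu
        calc w ^ y.val = (z ^ (-x).val * z ^ x.val) * w ^ y.val := by rw [h2, one_mul]
          _ = z ^ (-x).val * (z ^ x.val * w ^ y.val) := by rw [mul_assoc]
          _ = _ := by rw [h3, mul_one]
      apply hzw ((-x).val * (y⁻¹).val)
      rw [pow_mul, ← h1, ← pow_mul, ← pow_val_natCast ow]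
      push_cast
      simp [hy, ZMod.val_one]
    subst hy
    have h3 : z ^ x.val * w ^ (0 : ZMod p).val = 1 := hu
    rw [ZMod.val_zero, pow_zero, mul_one] at h3
    have h4 := orderOf_dvd_of_pow_eq_one h3
    rw [oz] at h4
    have h5 := Nat.eq_zero_of_dvd_of_lt h4 (ZMod.val_lt x)
    have : x = 0 := (ZMod.val_eq_zero x).1 h5
    rw [this]; rfl
  have hinj : Function.Injective E := by
    intro u v huv
    have : E (u + -v) = 1 := by rw [hadd, hneg, huv, mul_inv_cancel]
    have := hker _ this
    rwa [← sub_eq_add_neg, sub_eq_zero] at this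
  refine ⟨E, fun x y => rfl, hadd, hinj, ?_⟩
  have hmem : ∀ u, E u ∈ D := fun u => mul_mem (pow_mem hz _) (pow_mem hw _)
  let f : ZMod p × ZMod p → D := fun u => ⟨E u, hmem u⟩
  have hf : Function.Injective f := fun u v h => hinj (congrArg Subtype.val h)
  have hb : Function.Bijective f := by
    have : Fintype D := Fintype.ofFinite D
    rw [Fintype.bijective_iff_injective_and_card]
    refine ⟨hf, ?_⟩
    rw [← Nat.card_eq_fintype_card, ← Nat.card_eq_fintype_card, hD, Nat.card_prod, Nat.card_zmod]
    ring
  intro g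
  constructor
  · intro hg
    obtain ⟨u, hu⟩ := hb.2 ⟨g, hg⟩
    exact ⟨u, congrArg Subtype.val hu⟩
  · rintro ⟨u, rfl⟩; exact hmem u

theorem exists_loc {D : Subgroup G} {S T : Sylow p G}
    (hcard : ∀ S : Sylow p G, Nat.card S = p ^ 3) (hD : Nat.card D = p ^ 2)
    (hS : D ≤ S) (hT : D ≤ T) (hST : S ≠ T)
    (hX : ∀ S' : Sylow p G, D ≤ S' → centralizer (D : Set G) ≤ normalizer (S' : Set G)) :
    ∃ E, Loc p D S T E := by
  have hcomm : ∀ a ∈ D, ∀ b ∈ D, a * b = b * a := by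
    intro a ha b hb
    have := IsPGroup.commutative_of_card_eq_prime_sq hD ⟨a, ha⟩ ⟨b, hb⟩
    exact congrArg Subtype.val this
  have hpD : p ∣ Nat.card D := by rw [hD]; exact dvd_pow_self p (by norm_num)
  obtain ⟨z, hz, oz, cz⟩ := exists_central S.isPGroup' (le_normalizer_sq (hcard S) hD hS) hpD
  obtain ⟨w, hw, ow, cw⟩ := exists_central T.isPGroup' (le_normalizer_sq (hcard T) hD hT) hpD
  -- elements of `D` outside of `⟨z⟩` : general coordinates
  have key : ∀ S' S'' : Sylow p G, D ≤ S' → D ≤ S'' → S' ≠ S'' → ∀ z w : G, z ∈ D → orderOf z = p →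
      w ∈ D → orderOf w = p → (∀ k : ℕ, w ≠ z ^ k) → (∀ s ∈ S', s * z = z * s) →
      ∃ s ∈ S', ∃ k : ℕ, (k : ZMod p) ≠ 0 ∧ s * w * s⁻¹ = z ^ k * w := by
    intro S' S'' h' h'' hne z w hz oz hw ow hzw cz
    obtain ⟨s, hs, d, hd, hsd⟩ := not_le_centralizer hcard hD h' h'' hne hX
    obtain ⟨k, hk⟩ := comm_mem (hcard S') (h' hz) oz cz hs (h' hw)
    refine ⟨s, hs, k, ?_, hk⟩
    intro hk0
    apply hsd
    have hk1 : z ^ k = 1 := by rw [← pow_val_natCast oz, hk0]; simp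
    rw [hk1, one_mul, mul_inv_eq_iff_eq_mul] at hk
    obtain ⟨E, hE, _, _, hr⟩ := coord hD hz hw oz ow hzw
    obtain ⟨u, rfl⟩ := (hr d).1 hd
    rw [show u = (u.1, u.2) from rfl, hE]
    have c1 : Commute s z := cz s hs
    have c2 : Commute s w := hk
    exact (c1.pow_right _).mul_right (c2.pow_right _)
  have claim : ∀ S' S'' : Sylow p G, D ≤ S' → D ≤ S'' → ∀ z : G, z ∈ D → orderOf z = p → 
      (∀ s ∈ S', s * z = z * s) → (∀ s ∈ S'', s * z = z * s) → S' = S'' := by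
    intro S' S'' h' h'' z hz oz c' c''
    by_contra hne
    -- pick `w`
    have : ∃ w ∈ D, w ∉ zpowers z := by
      by_contra hcon
      push Not at hcon
      have h1 : Nat.card D ≤ Nat.card (zpowers z) := Nat.card_le_card_of_injective (Subgroup.inclusion (H := D) (K := zpowers z) hcon) (Subgroup.inclusion_injective _)
      rw [hD, Nat.card_zpowers, oz] at h1
      have := hp.out.one_lt
      nlinarith
    obtain ⟨w, hw, hwz⟩ := this
    obtain ⟨s, hs, hsw⟩ : ∃ s ∈ S', s * w ≠ w * s := by
      by_contra hcon
      push Not at hcon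
      obtain ⟨s, hs, d, hd, hsd⟩ := not_le_centralizer hcard hD h' h'' hne hX
      -- centralizer of s in D contains z and w
      apply hsd
      have hle : (D ⊓ centralizer {s} : Subgroup G) = D := by
        have hlt : zpowers z ≤ D ⊓ centralizer {s} := by
          rw [zpowers_le]
          refine ⟨hz, mem_centralizer_iff.2 ?_⟩
          rintro x rfl
          exact c' _ hs
        have hwm : w ∈ D ⊓ centralizer {s} := by
          refine ⟨hw, mem_centralizer_iff.2 ?_⟩
          rintro x rfl
          exact hcon _ hs
        have hdv := Subgroup.card_dvd_of_le hlt
        have hdv2 := Subgroup.card_dvd_of_le (inf_le_left : D ⊓ centralizer {s} ≤ D)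
        rw [hD] at hdv2
        obtain ⟨i, hi, hi2⟩ := (Nat.dvd_prime_pow hp.out).1 hdv2
        have hne1 : Nat.card (D ⊓ centralizer {s} : Subgroup G) ≠ p := by
          intro hh
          have : zpowers z = D ⊓ centralizer {s} := by
            apply Subgroup.eq_of_le_of_card_ge hlt
            rw [hh, Nat.card_zpowers, oz]
          rw [← this] at hwm
          exact hwz hwm
        apply Subgroup.eq_of_le_of_card_ge inf_le_left
        rw [hD, hi2]
        rw [Nat.card_zpowers, oz, hi2] at hdv
        interval_cases i
        · simp at hdv; exact absurd hdv hp.out.ne_one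
        · rw [pow_one] at hi2; exact absurd hi2 hne1
        · rfl
      rw [← hle] at hd
      exact mem_centralizer_iff.1 hd.2 s rfl
    obtain ⟨k, hk⟩ := comm_mem (hcard S') (h' hz) oz c' hs (h' hw)
    have hk0 : (k : ZMod p) ≠ 0 := by
      intro hk0
      have hk1 : z ^ k = 1 := by rw [← pow_val_natCast oz, hk0]; simp
      rw [hk1, one_mul, mul_inv_eq_iff_eq_mul] at hk
      exact hsw hk
    apply hne
    symm
    apply sylow_eq_of_le_normalizer
    intro τ hτ
    obtain ⟨j, hj⟩ := comm_mem (hcard S'') (h'' hz) oz c'' hτ (h'' hw)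
    have hpow : ∀ m : ℕ, s ^ m * w * (s ^ m)⁻¹ = z ^ (m * k) * w := by
      intro m
      induction m with
      | zero => simp
      | succ m ih =>
        have c1 : Commute (s ^ m) (z ^ k) := by
          have : Commute s z := c' s hs
          exact (this.pow_pow _ _)
        calc s ^ (m+1) * w * (s ^ (m+1))⁻¹ = s ^ m * (s * w * s⁻¹) * (s ^ m)⁻¹ := by
              rw [pow_succ]; group
          _ = s ^ m * z ^ k * w * (s ^ m)⁻¹ := by rw [hk]; group
          _ = z ^ k * (s ^ m * w * (s ^ m)⁻¹) := by rw [c1.eq]; group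
          _ = z ^ ((m+1) * k) * w := by rw [ih, ← mul_assoc, ← pow_add]; congr 2; ring
    let m := ((j : ZMod p) * (k : ZMod p)⁻¹).val
    have hm : z ^ (m * k) = z ^ j := by
      rw [← pow_val_natCast oz (m * k), ← pow_val_natCast oz j]
      congr 2
      push_cast
      simp only [m, ZMod.natCast_val, ZMod.cast_id', id]
      field_simp
    have hc : (s ^ m)⁻¹ * τ ∈ centralizer (D : Set G) := by
      have hw' : (s ^ m)⁻¹ * τ * w = w * ((s ^ m)⁻¹ * τ) := by
        have h1 := hpow m
        rw [hm, ← hj] at h1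
        have h2 : s ^ m * w = τ * w * τ⁻¹ * s ^ m := by rw [← h1]; group
        have : (s ^ m)⁻¹ * τ * w = (s ^ m)⁻¹ * (τ * w * τ⁻¹ * s ^ m) * ((s ^ m)⁻¹ * τ) := by group
        rw [this, ← h2]; group
      have hz' : (s ^ m)⁻¹ * τ * z = z * ((s ^ m)⁻¹ * τ) := by
        have a1 : Commute s z := c' s hs
        have a2 : Commute τ z := c'' τ hτ
        exact ((a1.pow_left m).inv_left.mul_left a2)
      have hle : (D ⊓ centralizer {(s ^ m)⁻¹ * τ} : Subgroup G) = D := by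
        have hlt : zpowers z ≤ D ⊓ centralizer {(s ^ m)⁻¹ * τ} := by
          rw [zpowers_le]
          refine ⟨hz, mem_centralizer_iff.2 ?_⟩
          rintro x rfl
          exact hz'
        have hwm : w ∈ D ⊓ centralizer {(s ^ m)⁻¹ * τ} := by
          refine ⟨hw, mem_centralizer_iff.2 ?_⟩
          rintro x rfl
          exact hw'
        have hdv := Subgroup.card_dvd_of_le hlt
        have hdv2 := Subgroup.card_dvd_of_le (inf_le_left : D ⊓ centralizer {(s ^ m)⁻¹ * τ} ≤ D)
        rw [hD] at hdv2
        obtain ⟨i, hi, hi2⟩ := (Nat.dvd_prime_pow hp.out).1 hdv2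
        have hne1 : Nat.card (D ⊓ centralizer {(s ^ m)⁻¹ * τ} : Subgroup G) ≠ p := by
          intro hh
          have : zpowers z = D ⊓ centralizer {(s ^ m)⁻¹ * τ} := by
            apply Subgroup.eq_of_le_of_card_ge hlt
            rw [hh, Nat.card_zpowers, oz]
          rw [← this] at hwm
          exact hwz hwm
        apply Subgroup.eq_of_le_of_card_ge inf_le_left
        rw [hD, hi2]
        rw [Nat.card_zpowers, oz, hi2] at hdv
        interval_cases i
        · simp at hdv; exact absurd hdv hp.out.ne_one
        · rw [pow_one] at hi2; exact absurd hi2 hne1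
        · rfl
      refine mem_centralizer_iff.2 ?_
      intro d hd
      have hd' : d ∈ D ⊓ centralizer {(s ^ m)⁻¹ * τ} := by rw [hle]; exact hd
      exact (mem_centralizer_iff.1 hd'.2 _ rfl).symm
    have h3 := hX S' h' hc
    have h4 : s ^ m ∈ normalizer (S' : Set G) := le_normalizer (pow_mem hs m)
    have : τ = s ^ m * ((s ^ m)⁻¹ * τ) := by group
    rw [this]
    exact mul_mem h4 h3
  have hzw : ∀ k : ℕ, w ≠ z ^ k := by
    intro k hk
    apply hST
    refine claim S T hS hT w hw ow ?_ cw
    intro s hs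
    have : Commute s z := cz s hs
    rw [hk]
    exact this.pow_right k
  have hwz : ∀ k : ℕ, z ≠ w ^ k := by
    intro k hk
    apply hST
    refine claim S T hS hT z hz oz cz ?_
    intro s hs
    have : Commute s w := cw s hs
    rw [hk]
    exact this.pow_right k
  obtain ⟨E, hE, hadd, hinj, hr⟩ := coord hD hz hw oz ow hzw
  have a1 : ∀ s, s * z = z * s → ∀ k : ℕ, s * w * s⁻¹ = z ^ k * w → Act E s 1 (k : ZMod p) 0 1 := by
    intro s hsz k hk x y
    have e1 : (s * w * s⁻¹) ^ y.val = s * w ^ y.val * s⁻¹ := conj_pow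
    have c0 : Commute (z ^ k) w := hcomm _ (pow_mem hz k) _ hw
    have e2 : s * z ^ x.val * s⁻¹ = z ^ x.val := by
      rw [mul_inv_eq_iff_eq_mul]
      have : Commute s z := hsz
      exact this.pow_right _
    have e3 : s * E (x, y) * s⁻¹ = (s * z ^ x.val * s⁻¹) * (s * w ^ y.val * s⁻¹) := by rw [hE]; group
    rw [e3, e2, ← e1, hk, c0.mul_pow, ← mul_assoc, hE, pow_val_add (by simpa using oz)]
    simp only [one_mul, zero_mul, zero_add]
    congr 2
    rw [← pow_mul, ← pow_val_natCast oz (k * y.val)]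
    push_cast
    simp
  have a2 : ∀ s, s * w = w * s → ∀ k : ℕ, s * z * s⁻¹ = w ^ k * z → Act E s 1 0 (k : ZMod p) 1 := by
    intro s hsw k hk x y
    have e1 : (s * z * s⁻¹) ^ x.val = s * z ^ x.val * s⁻¹ := conj_pow
    have c0 : Commute (w ^ k) z := hcomm _ (pow_mem hw k) _ hz
    have e2 : s * w ^ y.val * s⁻¹ = w ^ y.val := by
      rw [mul_inv_eq_iff_eq_mul]
      have : Commute s w := hsw
      exact this.pow_right _
    have e3 : s * E (x, y) * s⁻¹ = (s * z ^ x.val * s⁻¹) * (s * w ^ y.val * s⁻¹) := by rw [hE]; group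
    have c1 : Commute ((w ^ k) ^ x.val) (z ^ x.val) := c0.pow_pow _ _
    rw [e3, e2, ← e1, hk, c0.mul_pow, c1.eq, mul_assoc, hE, pow_val_add ow]
    simp only [one_mul, zero_mul, add_zero]
    congr 2
    rw [← pow_mul, ← pow_val_natCast ow (k * x.val)]
    push_cast
    simp
  have hE10 : E (1, 0) = z := by 
    have : Fact (1 < p) := ⟨hp.out.one_lt⟩
    rw [hE]; simp [ZMod.val_one]
  refine ⟨E, hadd, hinj, hr, hS, hT, hcard S, ?_, ?_, ?_, ?_⟩
  · intro s hs
    obtain ⟨k, hk⟩ := comm_mem (hcard S) (hS hz) oz cz hs (hS hw)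
    exact ⟨k, a1 s (cz s hs) k hk⟩
  · obtain ⟨s, hs, k, hk0, hk⟩ := key S T hS hT hST z w hz oz hw ow hzw cz
    exact ⟨s, hs, k, hk0, a1 s (cz s hs) k hk⟩
  · obtain ⟨s, hs, k, hk0, hk⟩ := key T S hT hS hST.symm w z hw ow hz oz hwz cw
    exact ⟨s, hs, k, hk0, a2 s (cw s hs) k hk⟩
  · intro S' h' c'
    rw [hE10] at c'
    exact claim S' S h' hS z hz oz c' cz

end loc
end ODL3


namespace ODL3

set_option linter.unusedSectionVars false

open Subgroup

section locc
variable {G : Type*} [Group G] [Finite G] {p : ℕ} [hp : Fact p.Prime]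

theorem conj_orbit (K : Subgroup G) (x : G) :
    Nat.card {y : G | ∃ k ∈ K, k * x * k⁻¹ = y} * Nat.card (K ⊓ centralizer {x} : Subgroup G) = Nat.card K := by
  let act : MulAction K G := MulAction.compHom G ((MulAut.conj : G →* MulAut G).comp K.subtype)
  have h1 := Nat.card_congr (MulAction.orbitProdStabilizerEquivGroup K x)
  rw [Nat.card_prod] at h1
  rw [← h1]
  congr 1
  · refine Nat.card_congr (Equiv.setCongr ?_)
    ext y
    constructor
    · rintro ⟨k, hk, rfl⟩
      exact ⟨⟨k, hk⟩, rfl⟩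
    · rintro ⟨k, hk⟩
      exact ⟨k, k.2, hk⟩
  · refine Nat.card_congr ⟨fun k => ⟨⟨k.1, k.2.1⟩, ?_⟩, fun k => ⟨k.1.1, k.1.2, ?_⟩, fun _ => rfl, fun _ => rfl⟩
    · change k.1 * x * k.1⁻¹ = x
      rw [mul_inv_eq_iff_eq_mul]
      exact (mem_centralizer_iff.1 k.2.2 x rfl).symm
    · refine mem_centralizer_iff.2 ?_
      rintro y rfl
      have : k.1.1 * y * k.1.1⁻¹ = y := k.2
      exact (mul_inv_eq_iff_eq_mul.1 this).symm

theorem pig {N : Type*} [Group N] [Finite N] (U : Subgroup N) {h g : N} (hh : h ∈ U) (hg : g ∉ U) :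
    ∃ k, 1 ≤ k ∧ k < U.index ∧ g⁻¹ * h ^ k * g ∈ U := by
  classical
  let f := U.index
  have hfin : Fintype (N ⧸ U) := Fintype.ofFinite _
  have hf : f = Fintype.card (N ⧸ U) := by rw [← Nat.card_eq_fintype_card]; rfl
  let F : ℕ → N ⧸ U := fun i => QuotientGroup.mk (h ^ i * g)
  have hne : ∀ i, F i ≠ QuotientGroup.mk 1 := by
    intro i hi
    have h1 := QuotientGroup.eq.1 hi.symm
    rw [inv_one, one_mul] at h1
    exact hg ((U.mul_mem_cancel_left (pow_mem hh i)).1 h1)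
  have hc : (Finset.univ.erase (QuotientGroup.mk 1 : N ⧸ U)).card < (Finset.range f).card := by
    rw [Finset.card_erase_of_mem (Finset.mem_univ _), Finset.card_univ, Finset.card_range, ← hf]
    have : 0 < f := by rw [hf]; exact Fintype.card_pos
    omega
  obtain ⟨i, hi, j, hj, hij, he⟩ := Finset.exists_ne_map_eq_of_card_lt_of_maps_to hc
    (f := F) (by intro i _; simp [hne i])
  have main : ∀ i j, i < j → j < f → F i = F j → ∃ k, 1 ≤ k ∧ k < f ∧ g⁻¹ * h ^ k * g ∈ U := by
    intro i j hij hj he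
    refine ⟨j - i, by omega, by omega, ?_⟩
    have h1 := QuotientGroup.eq.1 he
    have e : h ^ j = h ^ i * h ^ (j - i) := by rw [← pow_add]; congr 1; omega
    rw [e] at h1
    convert h1 using 1
    group
  rw [Finset.mem_range] at hi hj
  rcases lt_or_gt_of_ne hij with h1 | h1
  · exact main i j h1 hj he
  · exact main j i h1 hi he.symm

namespace Loc
variable {D : Subgroup G} {S T : Sylow p G} {E : ZMod p × ZMod p → G}

theorem zero (H : Loc p D S T E) : E 0 = 1 := by
  have := H.add 0 0
  rw [add_zero] at this
  exact (left_eq_mul.1 this)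

theorem smul_pow (H : Loc p D S T E) (a : ZMod p) (u : ZMod p × ZMod p) : E (a * u.1, a * u.2) = E u ^ a.val := by
  have : ∀ n : ℕ, E ((n : ZMod p) * u.1, (n : ZMod p) * u.2) = E u ^ n := by
    intro n
    induction n with
    | zero => simp; exact H.zero
    | succ n ih =>
      rw [pow_succ, ← ih, ← H.add]
      congr 1
      ext <;> simp <;> ring
  rw [← this]; simp

theorem mem (H : Loc p D S T E) (u) : E u ∈ D := (H.range _).2 ⟨u, rfl⟩

theorem mem_norm (H : Loc p D S T E) {g : G} {a b c d : ZMod p} (h : Act E g a b c d) : g ∈ normalizer (D : Set G) := by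
  apply mem_norm_of
  intro k hk
  obtain ⟨u, rfl⟩ := (H.range k).1 hk
  rw [h u.1 u.2]
  exact H.mem _

theorem exU (H : Loc p D S T E) (k : ZMod p) : ∃ s ∈ S, Act E s 1 k 0 1 := by
  obtain ⟨s, hs, r, hr, h⟩ := H.exS
  refine ⟨s ^ (k * r⁻¹).val, pow_mem hs _, (h.upper_pow _).congr rfl ?_ rfl rfl⟩
  simp; field_simp

theorem exL (H : Loc p D S T E) (k : ZMod p) : ∃ s ∈ T, Act E s 1 0 k 1 := by
  obtain ⟨s, hs, r, hr, h⟩ := H.exT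
  refine ⟨s ^ (k * r⁻¹).val, pow_mem hs _, (h.lower_pow _).congr rfl rfl ?_ rfl⟩
  simp; field_simp

theorem ex_act (H : Loc p D S T E) {g : G} (hg : g ∈ normalizer (D : Set G)) : ∃ a b c d, Act E g a b c d := by
  have h1 : ∀ u, ∃ v, E v = g * E u * g⁻¹ := fun u =>
    (H.range _).1 ((mem_normalizer_iff.1 hg _).1 (H.mem u))
  choose f hf using h1
  have fadd : ∀ u v, f (u + v) = f u + f v := by
    intro u v
    apply H.inj
    rw [H.add, hf, hf, hf, H.add]; group
  have fsmul : ∀ (a : ZMod p) (u : ZMod p × ZMod p), f (a * u.1, a * u.2) = (a * (f u).1, a * (f u).2) := by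
    intro a u
    apply H.inj
    rw [H.smul_pow, hf, hf, H.smul_pow, conj_pow]
  refine ⟨(f (1, 0)).1, (f (0, 1)).1, (f (1, 0)).2, (f (0, 1)).2, ?_⟩
  intro x y
  rw [← hf]
  congr 1
  have e : (x, y) = (x * ((1 : ZMod p), (0 : ZMod p)).1, x * ((1 : ZMod p), (0 : ZMod p)).2) + 
    (y * ((0 : ZMod p), (1 : ZMod p)).1, y * ((0 : ZMod p), (1 : ZMod p)).2) := by ext <;> simp
  rw [e, fadd, fsmul, fsmul]
  ext <;> simp <;> ring

theorem homog1 (H : Loc p D S T E) {u : ZMod p × ZMod p} (hu : u ≠ 0) :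
    ∃ g ∈ normalizer (D : Set G), g * E (1, 0) * g⁻¹ = E u := by
  obtain ⟨x, y⟩ := u
  by_cases hy : y = 0
  · subst hy
    have hx : x ≠ 0 := fun h => hu (by rw [h]; rfl)
    obtain ⟨a, _, ha⟩ := H.exL 1
    obtain ⟨b, _, hb⟩ := H.exU (x - 1)
    obtain ⟨c, _, hc⟩ := H.exL (-x⁻¹)
    have hm := hc.mul (hb.mul ha)
    refine ⟨_, H.mem_norm hm, ?_⟩
    rw [hm]
    congr 2
    · simp
    · field_simp; ring
  · obtain ⟨a, _, ha⟩ := H.exL y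
    obtain ⟨b, _, hb⟩ := H.exU ((x - 1) / y)
    have hm := hb.mul ha
    refine ⟨_, H.mem_norm hm, ?_⟩
    rw [hm]
    congr 2
    · field_simp; ring
    · simp

theorem homog (H : Loc p D S T E) {a b : G} (ha : a ∈ D) (hb : b ∈ D) (ha1 : a ≠ 1) (hb1 : b ≠ 1) :
    ∃ g ∈ normalizer (D : Set G), g * a * g⁻¹ = b := by
  obtain ⟨u, rfl⟩ := (H.range a).1 ha
  obtain ⟨v, rfl⟩ := (H.range b).1 hb
  obtain ⟨g, hg, hgu⟩ := H.homog1 (u := u) (by rintro rfl; exact ha1 H.zero)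
  obtain ⟨k, hk, hkv⟩ := H.homog1 (u := v) (by rintro rfl; exact hb1 H.zero)
  refine ⟨k * g⁻¹, mul_mem hk (inv_mem hg), ?_⟩
  rw [← hgu, ← hkv]; group

theorem diag (H : Loc p D S T E) {t : ZMod p} (ht : t ≠ 0) : ∃ h, Act E h t 0 0 t⁻¹ := by
  obtain ⟨a, _, ha⟩ := H.exU t
  obtain ⟨b, _, hb⟩ := H.exL (-t⁻¹)
  obtain ⟨c, _, hc⟩ := H.exU (-1)
  obtain ⟨d, _, hd⟩ := H.exL 1
  have hm := (ha.mul (hb.mul ha)).mul (hc.mul (hd.mul hc))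
  refine ⟨_, hm.congr ?_ ?_ ?_ ?_⟩ <;> field_simp <;> ring

theorem norm_of (H : Loc p D S T E) {n : G} {a b d : ZMod p} (h : Act E n a b 0 d) : n ∈ normalizer (S : Set G) := by
  have hn := H.mem_norm h
  have : n⁻¹ • S = S := by
    apply H.fix
    · intro x hx
      rw [mem_smul_sylow]
      have := (mem_normalizer_iff.1 hn x).1 hx
      rw [inv_inv]
      exact H.leS this
    · intro s hs
      rw [← SetLike.mem_coe] at hs
      have hs' : n * s * n⁻¹ ∈ S := by
        have := mem_smul_sylow.1 hs
        simpa using this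
      obtain ⟨k, hk⟩ := H.actS _ hs'
      have h1 := hk a 0
      have h2 := h 1 0
      simp at h1 h2
      rw [← h2] at h1
      have e : s * E (1, 0) * s⁻¹ = n⁻¹ * (n * s * n⁻¹ * (n * E (1, 0) * n⁻¹) * (n * (s⁻¹ * n⁻¹))) * n := by group
      rw [h1] at e
      have e2 : n⁻¹ * (n * E (1, 0) * n⁻¹) * n = E (1, 0) := by group
      rw [e2] at e
      exact mul_inv_eq_iff_eq_mul.1 e
  have h2 := inv_mem (Sylow.smul_eq_iff_mem_normalizer.1 this)
  rwa [inv_inv] at h2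

theorem c_zero (H : Loc p D S T E) {n : G} {a b c d : ZMod p} (h : Act E n a b c d) (hn : n ∈ normalizer (S : Set G)) : c = 0 := by
  obtain ⟨s, hs, hs1⟩ := H.exU 1
  have hs' : n⁻¹ * s * n ∈ S := by
    have := (mem_normalizer_iff.1 (inv_mem hn) s).1 hs
    rw [inv_inv] at this
    exact this
  obtain ⟨k, hk⟩ := H.actS _ hs'
  have h1 := hk 1 0
  have h2 := h 1 0
  have h3 := hs1 a c
  simp only [mul_one, mul_zero, add_zero, one_mul, zero_mul] at h1 h2 h3
  have e : s * E (a, c) * s⁻¹ = n * (n⁻¹ * s * n * E (1, 0) * (n⁻¹ * s * n)⁻¹) * n⁻¹ := by rw [← h2]; group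
  rw [h1, h2, h3] at e
  have := congrArg Prod.fst (H.inj e)
  simpa using this

theorem a_ne_zero (H : Loc p D S T E) {n : G} {a b c d : ZMod p} (h : Act E n a b c d) (hc : c = 0) : a ≠ 0 := by
  rintro rfl
  subst hc
  have h1 := h 1 0
  simp only [mul_one, mul_zero, add_zero] at h1
  rw [show ((0 : ZMod p), (0 : ZMod p)) = 0 from rfl, H.zero] at h1
  have h2 : E (1, 0) = 1 := by
    have : E (1, 0) = n⁻¹ * (n * E (1, 0) * n⁻¹) * n := by group
    rw [this, h1]; group
  rw [← H.zero] at h2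
  have := congrArg Prod.fst (H.inj h2)
  simp at this

theorem cent_mem (H : Loc p D S T E) {s : G} (hs : s ∈ S) (h : Act E s 1 0 0 1) : s ∈ D := by
  let K : Subgroup G := S ⊓ centralizer (D : Set G)
  have hD2 : Nat.card D = p ^ 2 := by
    have : Nat.card D = Nat.card (ZMod p × ZMod p) := by
      symm
      refine Nat.card_congr (Equiv.ofBijective (fun u => (⟨E u, H.mem u⟩ : D)) ⟨?_, ?_⟩)
      · intro u v huv; exact H.inj (congrArg Subtype.val huv)
      · rintro ⟨g, hg⟩
        obtain ⟨u, hu⟩ := (H.range g).1 hg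
        exact ⟨u, Subtype.ext hu⟩
    rw [this, Nat.card_prod, Nat.card_zmod]; ring
  have hDK : D ≤ K := by
    refine le_inf H.leS ?_
    intro x hx
    refine mem_centralizer_iff.2 ?_
    intro y hy
    have := IsPGroup.commutative_of_card_eq_prime_sq hD2 ⟨y, hy⟩ ⟨x, hx⟩
    exact congrArg Subtype.val this
  have hKS : Nat.card K ∣ p ^ 3 := by
    rw [← H.cardS]; exact card_dvd_of_le inf_le_left
  obtain ⟨i, hi, hi2⟩ := (Nat.dvd_prime_pow hp.out).1 hKS
  have hsK : s ∈ K := by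
    refine ⟨hs, mem_centralizer_iff.2 ?_⟩
    intro y hy
    obtain ⟨u, rfl⟩ := (H.range y).1 hy
    have h1 := h u.1 u.2
    simp only [one_mul, zero_mul, add_zero, zero_add] at h1
    exact (mul_inv_eq_iff_eq_mul.1 h1).symm
  have hne : i ≠ 3 := by
    rintro rfl
    have : K = S := by
      apply Subgroup.eq_of_le_of_card_ge inf_le_left
      rw [hi2, H.cardS]
    obtain ⟨s', hs', hs1⟩ := H.exU 1
    have h2 : s' ∈ K := by rw [this]; exact hs'
    have h3 := mem_centralizer_iff.1 h2.2 _ (H.mem (0, 1))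
    have h4 := hs1 0 1
    rw [← h3] at h4
    simp only [mul_inv_cancel_right] at h4
    have := congrArg Prod.fst (H.inj h4)
    simp at this
  have hK : D = K := by
    apply Subgroup.eq_of_le_of_card_ge hDK
    rw [hD2, hi2]
    exact Nat.pow_le_pow_right hp.out.pos (by omega)
  rw [hK]; exact hsK

/-- stabilizer-orbit counting in subgroups of the stabilizer of the flag. -/
theorem flag_orbit (H : Loc p D S T E) {V : Subgroup G} (hV : V ≤ normalizer (D : Set G) ⊓ normalizer (S : Set G))
    (hd : ∀ t : ZMod p, t ≠ 0 → ∃ h ∈ V, Act E h t 0 0 t⁻¹) :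
    (p - 1) * Nat.card (V ⊓ centralizer {E (1, 0)} : Subgroup G) = Nat.card V := by
  rw [← conj_orbit V (E (1, 0))]
  congr 1
  have : Nat.card (ZMod p)ˣ = p - 1 := by
    rw [Nat.card_eq_fintype_card, ZMod.card_units]
  rw [← this]
  symm
  have hinj : Function.Injective (fun t : (ZMod p)ˣ => E ((t : ZMod p), 0)) := by
    intro t t' h
    exact Units.ext (congrArg Prod.fst (H.inj h))
  rw [← Nat.card_range_of_injective hinj]
  refine Nat.card_congr (Equiv.setCongr ?_)
  ext y
  constructor
  swap
  · rintro ⟨t, rfl⟩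
    obtain ⟨h, hh, ha⟩ := hd t t.ne_zero
    refine ⟨h, hh, ?_⟩
    rw [ha]
    simp only [mul_one, zero_mul, mul_zero, add_zero]
  · rintro ⟨k, hk, rfl⟩
    obtain ⟨a, b, c, d, h⟩ := H.ex_act (hV hk).1
    have hc := H.c_zero h (hV hk).2
    have ha := H.a_ne_zero h hc
    refine ⟨Units.mk0 a ha, ?_⟩
    rw [h, hc]; simp

theorem dvdV (H : Loc p D S T E) {V : Subgroup G} (hV : V ≤ normalizer (D : Set G) ⊓ normalizer (S : Set G))
    (hS : (S : Subgroup G) ≤ V)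
    (hd : ∀ t : ZMod p, t ≠ 0 → ∃ h ∈ V, Act E h t 0 0 t⁻¹) :
    p ^ 3 * (p - 1) ∣ Nat.card V := by
  have h1 : p ^ 3 ∣ Nat.card V := by rw [← H.cardS]; exact card_dvd_of_le hS
  have h2 : p - 1 ∣ Nat.card V := ⟨_, (H.flag_orbit hV hd).symm⟩
  refine Nat.Coprime.mul_dvd_of_dvd_of_dvd ?_ h1 h2
  apply Nat.Coprime.pow_left
  rw [Nat.coprime_comm]
  exact (Nat.coprime_self_sub_left hp.out.one_lt.le).2 (by simp)

theorem leS_U (H : Loc p D S T E) (hcD : Nat.card D = p ^ 2) : (S : Subgroup G) ≤ normalizer (D : Set G) ⊓ normalizer (S : Set G) :=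
  le_inf (le_normalizer_sq H.cardS hcD H.leS) le_normalizer

theorem diag_U (H : Loc p D S T E) (t : ZMod p) (ht : t ≠ 0) : 
    ∃ h ∈ normalizer (D : Set G) ⊓ normalizer (S : Set G), Act E h t 0 0 t⁻¹ := by
  obtain ⟨h, hh⟩ := H.diag ht
  exact ⟨h, ⟨H.mem_norm hh, H.norm_of hh⟩, hh⟩

theorem card_norm (H : Loc p D S T E) : Nat.card (normalizer (D : Set G)) = 
    (p + 1) * Nat.card (normalizer (D : Set G) ⊓ normalizer (S : Set G) : Subgroup G) := by
  have h1 := conj_orbit (normalizer (D : Set G)) (E (1, 0))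
  have h2 := H.flag_orbit le_rfl H.diag_U
  have e : normalizer (D : Set G) ⊓ normalizer (S : Set G) ⊓ centralizer {E (1, 0)} = 
    normalizer (D : Set G) ⊓ centralizer {E (1, 0)} := by
    apply le_antisymm
    · exact inf_le_inf_right _ inf_le_left
    · rintro n ⟨hn, hc⟩
      refine ⟨⟨hn, ?_⟩, hc⟩
      obtain ⟨a, b, c, d, h⟩ := H.ex_act hn
      have h3 := mem_centralizer_iff.1 hc _ rfl
      have h4 := h 1 0
      rw [← h3] at h4
      simp only [mul_inv_cancel_right] at h4
      have h5 := congrArg Prod.snd (H.inj h4)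
      simp at h5
      subst h5
      exact H.norm_of h
  rw [e] at h2
  have h3 : Nat.card {y : G | ∃ k ∈ normalizer (D : Set G), k * E (1, 0) * k⁻¹ = y} = (p + 1) * (p - 1) := by
    have e1 : Nat.card ({0}ᶜ : Set (ZMod p × ZMod p)) = (p + 1) * (p - 1) := by
      rw [Nat.card_coe_set_eq, Set.ncard_compl, Set.ncard_singleton, Nat.card_prod, Nat.card_zmod]
      exact Nat.mul_self_sub_mul_self_eq p 1 |>.trans (by simp)
    rw [← e1]
    have hinj : Function.Injective (fun t : ({0}ᶜ : Set (ZMod p × ZMod p)) => E t) := by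
      intro t t' h
      exact Subtype.ext (H.inj h)
    rw [← Nat.card_range_of_injective hinj]
    refine Nat.card_congr (Equiv.setCongr ?_)
    ext y
    constructor
    · rintro ⟨k, hk, rfl⟩
      obtain ⟨v, hv⟩ := (H.range _).1 ((mem_normalizer_iff.1 hk _).1 (H.mem (1, 0)))
      refine ⟨⟨v, ?_⟩, hv⟩
      rintro rfl
      rw [H.zero] at hv
      have h2 : E (1, 0) = 1 := by
        have : E (1, 0) = k⁻¹ * (k * E (1, 0) * k⁻¹) * k := by group
        rw [this, ← hv]; group
      rw [← H.zero] at h2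
      have := congrArg Prod.fst (H.inj h2)
      simp at this
    · rintro ⟨v, rfl⟩
      exact H.homog1 v.2
  rw [h3] at h1
  rw [← h1, ← h2]; ring

theorem exists_det (H : Loc p D S T E) : ∃ δ : (normalizer (D : Set G)) →* ZMod p, ∀ g : normalizer (D : Set G), ∀ a b c d,
    Act E (g : G) a b c d → δ g = a * d - b * c := by
  have h1 : ∀ g : normalizer (D : Set G), ∃ a b c d, Act E (g : G) a b c d := fun g => H.ex_act g.2
  choose a b c d h using h1
  have key : ∀ g : normalizer (D : Set G), ∀ a' b' c' d',
    Act E (g : G) a' b' c' d' → a g * d g - b g * c g = a' * d' - b' * c' := by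
    intro g a' b' c' d' h'
    obtain ⟨e1, e2, e3, e4⟩ := Act.uniq H.inj (h g) h'
    rw [e1, e2, e3, e4]
  refine ⟨⟨⟨fun g => a g * d g - b g * c g, ?_⟩, ?_⟩, key⟩
  · rw [key 1 1 0 0 1 Act.one]; ring
  · intro g g'
    change _ = (a g * d g - b g * c g) * (a g' * d g' - b g' * c g')
    have h2 : Act E ((g * g' : normalizer (D : Set G)) : G) _ _ _ _ := (h g).mul (h g')
    change a (g * g') * d (g * g') - b (g * g') * c (g * g') = _
    rw [key _ _ _ _ _ h2]; ring

theorem twist (H : Loc p D S T E) {g h : G} {t : ZMod p} (ht : t ≠ 0) (hh : Act E h t 0 0 t⁻¹)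
    (hg : g ∈ normalizer (S : Set G)) (hgD : g ∉ normalizer (D : Set G)) {k : ℕ}
    (hk : g⁻¹ * h ^ k * g ∈ normalizer (D : Set G)) (hk' : g⁻¹ * h ^ k * g ∈ normalizer (S : Set G)) :
    ∃ b, Act E (g⁻¹ * h ^ k * g) (t ^ k) b 0 (t ^ (2 * k)) := by
  have memS : ∀ s ∈ S, g * s * g⁻¹ ∈ S := fun s hs => (mem_normalizer_iff.1 hg s).1 hs
  have memS' : ∀ s ∈ S, g⁻¹ * s * g ∈ S := fun s hs => by
    have := (mem_normalizer_iff.1 (inv_mem hg) s).1 hs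
    rw [inv_inv] at this
    exact this
  -- the image of `E (1,0)`
  have hZ : ∃ e, e ≠ 0 ∧ g * E (1, 0) * g⁻¹ = E (e, 0) := by
    have hcen : ∀ s ∈ S, s * (g * E (1, 0) * g⁻¹) * s⁻¹ = g * E (1, 0) * g⁻¹ := by
      intro s hs
      obtain ⟨r, hr⟩ := H.actS _ (memS' s hs)
      have h1 := hr 1 0
      simp only [mul_one, mul_zero, add_zero] at h1
      have : s * (g * E (1, 0) * g⁻¹) * s⁻¹ = g * (g⁻¹ * s * g * E (1, 0) * (g⁻¹ * s * g)⁻¹) * g⁻¹ := by group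
      rw [this, h1]
    have hmS : g * E (1, 0) * g⁻¹ ∈ S := memS _ (H.leS (H.mem _))
    have hmD : g * E (1, 0) * g⁻¹ ∈ D := by
      apply H.cent_mem hmS
      intro x y
      have h1 := hcen _ (H.leS (H.mem (x, y)))
      rw [mul_inv_eq_iff_eq_mul] at h1 ⊢
      rw [← h1]; simp
    obtain ⟨⟨e, y⟩, hu⟩ := (H.range _).1 hmD
    obtain ⟨s, hs, hs1⟩ := H.exU 1
    have h2 := hcen s hs
    rw [← hu, hs1] at h2
    have h3 := congrArg Prod.fst (H.inj h2)
    simp at h3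
    subst h3
    refine ⟨e, ?_, hu.symm⟩
    rintro rfl
    rw [show ((0 : ZMod p), (0 : ZMod p)) = 0 from rfl, H.zero] at hu
    have h2 : E (1, 0) = 1 := by
      have : E (1, 0) = g⁻¹ * (g * E (1, 0) * g⁻¹) * g := by group
      rw [this, ← hu]; group
    rw [← H.zero] at h2
    have := congrArg Prod.fst (H.inj h2)
    simp at this
  obtain ⟨e, he, hge⟩ := hZ
  have hgx : ∀ x, g * E (x, 0) * g⁻¹ = E (x * e, 0) := by
    intro x
    have h1 := H.smul_pow x (1, 0)
    have h2 := H.smul_pow x (e, 0)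
    simp only [mul_one, mul_zero] at h1 h2
    rw [h1, h2, ← hge, conj_pow]
  obtain ⟨a, b, c, d, hact⟩ := H.ex_act hk
  have hc := H.c_zero hact hk'
  subst hc
  have hhk := hh.diag_pow k
  have ha : a = t ^ k := by
    have h1 := hact 1 0
    simp only [mul_one, mul_zero, add_zero] at h1
    have h2 := hhk e 0
    have h3 : h ^ k * (g * E (1, 0) * g⁻¹) * (h ^ k)⁻¹ = g * (g⁻¹ * h ^ k * g * E (1, 0) * (g⁻¹ * h ^ k * g)⁻¹) * g⁻¹ := by
      group
    rw [h1, hge, h2, hgx] at h3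
    have h4 := congrArg Prod.fst (H.inj h3)
    simp only [mul_zero, add_zero] at h4
    exact (mul_right_cancel₀ he h4).symm
  have hd2 : g * E (0, 1) * g⁻¹ ∈ S := memS _ (H.leS (H.mem _))
  obtain ⟨r, hr⟩ := H.actS _ hd2
  have hr0 : r ≠ 0 := by
    rintro rfl
    have h1 := H.cent_mem hd2 hr
    apply hgD
    apply mem_norm_of
    intro x hx
    obtain ⟨⟨x, y⟩, rfl⟩ := (H.range x).1 hx
    have h2 : E (x, y) = E (x, 0) * E (0, 1) ^ y.val := by
      have := H.smul_pow y (0, 1)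
      simp only [mul_one, mul_zero] at this
      rw [← this, ← H.add]; simp
    have h3 : g * E (x, y) * g⁻¹ = (g * E (x, 0) * g⁻¹) * (g * E (0, 1) * g⁻¹) ^ y.val := by
      rw [h2, conj_pow]; group
    rw [h3, hgx]
    exact mul_mem (H.mem _) (pow_mem h1 _)
  have htk : t ^ k ≠ 0 := pow_ne_zero _ ht
  have hd : d = t ^ (2 * k) := by
    have h1 := hact 0 1
    simp only [mul_one, mul_zero, zero_add] at h1
    have h2 : E (b, d) = E (b, 0) * E (0, 1) ^ d.val := by
      have := H.smul_pow d (0, 1)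
      simp only [mul_one, mul_zero] at this
      rw [← this, ← H.add]; simp
    have h3 : g * E (b, d) * g⁻¹ = (g * E (b, 0) * g⁻¹) * (g * E (0, 1) * g⁻¹) ^ d.val := by
      rw [h2, conj_pow]; group
    have h4 : h ^ k * (g * E (0, 1) * g⁻¹) * (h ^ k)⁻¹ = g * (g⁻¹ * h ^ k * g * E (0, 1) * (g⁻¹ * h ^ k * g)⁻¹) * g⁻¹ := by
      group
    rw [h1, h3, hgx, mul_inv_eq_iff_eq_mul] at h4
    have hEact : Act E (E (b * e, 0)) 1 0 0 1 := by
      intro x y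
      rw [mul_inv_eq_iff_eq_mul, ← H.add, ← H.add]
      congr 1
      simp [add_comm]
    have h5 := hhk.mul hr
    rw [h4] at h5
    have h6 := (hEact.mul (hr.upper_pow d.val)).mul hhk
    obtain ⟨_, h7, _, _⟩ := Act.uniq H.inj h5 h6
    simp at h7
    have h8 : t ^ k * r * t ^ k = d * r := by
      rw [h7]; field_simp
    have h9 : (t ^ (2 * k) - d) * r = 0 := by
      rw [two_mul, pow_add, sub_mul, sub_eq_zero, ← h8]; ring
    rcases mul_eq_zero.1 h9 with h10 | h10
    · exact (sub_eq_zero.1 h10).symm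
    · exact absurd h10 hr0
  exact ⟨b, by rw [← ha, ← hd]; exact hact⟩

/-- the key divisibility used to show `N(S) ≤ N(D)`. -/
theorem f_arg (H : Loc p D S T E) (hcD : Nat.card D = p ^ 2) (hne : ¬ normalizer (S : Set G) ≤ normalizer (D : Set G)) :
    ∃ k, 1 ≤ k ∧ k * Nat.card (normalizer (D : Set G) ⊓ normalizer (S : Set G) : Subgroup G) <
        Nat.card (normalizer (S : Set G)) ∧
      p ^ 3 * (p - 1) * ((p - 1) / Nat.gcd (p - 1) (3 * k)) ∣
        Nat.card (normalizer (D : Set G) ⊓ normalizer (S : Set G) : Subgroup G) := by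
  obtain ⟨g, hgS, hgD⟩ := Set.not_subset.1 hne
  obtain ⟨t, ht⟩ := IsCyclic.exists_ofOrder_eq_natCard (α := (ZMod p)ˣ)
  rw [Nat.card_eq_fintype_card, ZMod.card_units] at ht
  obtain ⟨h, hhU, hh⟩ := H.diag_U t t.ne_zero
  let NS : Subgroup G := normalizer (S : Set G)
  let ND : Subgroup G := normalizer (D : Set G)
  let U := ND ⊓ NS
  change h ∈ U at hhU
  obtain ⟨k, hk1, hk2, hk3⟩ := pig (U.subgroupOf NS) (h := ⟨h, hhU.2⟩) (g := ⟨g, hgS⟩)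
    (by exact hhU) (by intro hh; exact hgD (mem_subgroupOf.1 hh).1)
  have hk4 : g⁻¹ * h ^ k * g ∈ U := hk3
  have hUN : U ≤ NS := inf_le_right
  have hidx : Nat.card U * (U.subgroupOf NS).index = Nat.card NS := by
    have := Subgroup.card_mul_index (U.subgroupOf NS)
    rw [Nat.card_congr (subgroupOfEquivOfLe hUN).toEquiv] at this
    exact this
  have hUpos : 0 < Nat.card U := Nat.card_pos
  refine ⟨k, hk1, ?_, ?_⟩
  · change k * Nat.card U < Nat.card NS
    rw [← hidx, mul_comm]
    exact Nat.mul_lt_mul_of_pos_left hk2 hUpos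
  obtain ⟨b, hb⟩ := H.twist t.ne_zero hh hgS hgD hk4.1 hk4.2
  obtain ⟨δ, hδ⟩ := H.exists_det
  let ι : U →* ND := Subgroup.inclusion inf_le_left
  let δ' : U →* (ZMod p)ˣ := (δ.comp ι).toHomUnits
  have hδ' : ∀ u : U, ∀ a b c d, Act E (u : G) a b c d → (δ' u : ZMod p) = a * d - b * c := by
    intro u a b c d hu
    exact hδ (ι u) a b c d hu
  let V : Subgroup G := δ'.ker.map U.subtype
  have hVU : V ≤ U := map_subtype_le _
  have memV : ∀ u a b c d, u ∈ U → Act E u a b c d → a * d - b * c = 1 → u ∈ V := by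
    intro u a b c d hu hact h1
    refine ⟨⟨u, hu⟩, ?_, rfl⟩
    rw [SetLike.mem_coe, MonoidHom.mem_ker]
    apply Units.ext
    rw [hδ' ⟨u, hu⟩ a b c d hact, h1]; rfl
  have hcV : Nat.card V = Nat.card δ'.ker := by
    exact (Nat.card_congr (δ'.ker.equivMapOfInjective _ U.subtype_injective).toEquiv).symm
  have d1 := H.dvdV (V := V) hVU (by
    intro s hs
    obtain ⟨r, hr⟩ := H.actS s hs
    exact memV s _ _ _ _ (H.leS_U hcD hs) hr (by ring)) (by
    intro t ht
    obtain ⟨h, hh, hh'⟩ := H.diag_U t ht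
    exact ⟨h, memV h _ _ _ _ hh hh' (by rw [mul_inv_cancel₀ ht]; ring), hh'⟩)
  have d2 : (p - 1) / Nat.gcd (p - 1) (3 * k) ∣ Nat.card δ'.range := by
    have e : δ' ⟨_, hk4⟩ = t ^ (3 * k) := by
      apply Units.ext
      rw [hδ' _ _ _ _ _ hb]
      simp only [mul_zero, sub_zero, Units.val_pow_eq_pow_val]
      ring
    have : orderOf (t ^ (3 * k)) ∣ Nat.card δ'.range := by
      have h5 := orderOf_dvd_natCard (⟨δ' ⟨_, hk4⟩, ⟨_, rfl⟩⟩ : δ'.range)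
      rw [← Subgroup.orderOf_coe] at h5
      rw [← e]
      exact h5
    rw [orderOf_pow, ht] at this
    exact this
  have e3 : Nat.card U = Nat.card δ'.ker * Nat.card δ'.range := by
    rw [← Subgroup.card_mul_index δ'.ker, Subgroup.index_ker]
  change _ ∣ Nat.card U
  rw [e3, ← hcV]
  exact Nat.mul_dvd_mul d1 d2

/-- if `D` normalizes one of its conjugates, it is equal to it. -/
theorem nofix (H : Loc p D S T E) (hcard : ∀ S : Sylow p G, Nat.card S = p ^ 3) (hcD : Nat.card D = p ^ 2)
    (hle : normalizer (S : Set G) ≤ normalizer (D : Set G))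
    {g : G} (hg : ∀ d ∈ D, ∀ x ∈ D, d * (g * x * g⁻¹) * d⁻¹ ∈ D.map (MulAut.conj g).toMonoidHom) :
    g ∈ normalizer (D : Set G) := by
  let D2 : Subgroup G := D.map (MulAut.conj g).toMonoidHom
  have hmem2 : ∀ x, x ∈ D2 ↔ ∃ y ∈ D, g * y * g⁻¹ = x := fun x => Iff.rfl
  have hDN : D ≤ normalizer (D2 : Set G) := by
    intro d hd
    apply mem_norm_of
    intro x hx
    obtain ⟨y, hy, rfl⟩ := (hmem2 x).1 hx
    exact hg d hd y hy
  have hDp : IsPGroup p D := IsPGroup.of_card hcD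
  have hD2p : IsPGroup p D2 := hDp.map _
  have hsup : IsPGroup p (D ⊔ D2 : Subgroup G) := hDp.to_sup_of_normal_right' hD2p hDN
  obtain ⟨S1, hS1⟩ := hsup.exists_le_sylow
  have h1 : D ≤ S1 := le_sup_left.trans hS1
  have h2 : D2 ≤ S1 := le_sup_right.trans hS1
  let S2 := g⁻¹ • S1
  have h3 : D ≤ S2 := by
    intro x hx
    apply mem_smul_sylow.2
    rw [inv_inv]
    exact h2 ((hmem2 _).2 ⟨x, hx, rfl⟩)
  obtain ⟨n, hn, hnS⟩ := sylow_conj_in (le_normalizer_sq (hcard S1) hcD h1) (le_normalizer_sq (hcard S2) hcD h3)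
  obtain ⟨m, hm, hmS⟩ := sylow_conj_in (le_normalizer_sq (hcard S) hcD H.leS) (le_normalizer_sq (hcard S1) hcD h1)
  -- g n ∈ N(S1) ; m⁻¹ (g n) m ∈ N(S)
  have h4 : (g * n) • S1 = S1 := by
    rw [mul_smul, hnS, smul_inv_smul]
  have h5 : (m⁻¹ * (g * n) * m) • S = S := by
    rw [mul_smul, hmS, mul_smul, h4, ← hmS, inv_smul_smul]
  have h6 := hle (Sylow.smul_eq_iff_mem_normalizer.1 h5)
  have : g = m * (m⁻¹ * (g * n) * m) * m⁻¹ * n⁻¹ := by group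
  rw [this]
  exact mul_mem (mul_mem (mul_mem hm h6) (inv_mem hm)) (inv_mem hn)

end Loc
end locc
end ODL3


namespace ODL3

set_option linter.unusedSectionVars false

open Subgroup

section num
variable {G : Type*} [Group G] [Finite G] {p : ℕ} [hp : Fact p.Prime]

theorem dvd_card_of_orbits {Q α : Type*} [Group Q] [MulAction Q α] [Finite α] (m : ℕ)
    (h : ∀ a : α, m ∣ Nat.card (MulAction.orbit Q a)) : m ∣ Nat.card α := by
  classical
  have : Fintype (Quotient (MulAction.orbitRel Q α)) := Fintype.ofFinite _
  rw [Nat.card_congr (MulAction.selfEquivSigmaOrbits Q α), Nat.card_sigma]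
  apply Finset.dvd_sum
  intro i _
  exact h _

theorem fixall {P K : Subgroup G} (hP : IsPGroup p P) (h : P ≤ normalizer (K : Set G))
    (hK : Nat.card K < p) {x y : G} (hx : x ∈ P) (hy : y ∈ K) : x * y = y * x := by
  let act := conjActOn P K h
  have h1 := hP.card_modEq_card_fixedPoints K
  have h2 : Nat.card (MulAction.fixedPoints P K) ≤ Nat.card K :=
    Nat.card_le_card_of_injective _ Subtype.val_injective
  have h3 := Nat.ModEq.eq_of_lt_of_lt h1 hK (lt_of_le_of_lt h2 hK)
  have h4 : (MulAction.fixedPoints P K) = Set.univ := by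
    apply Set.eq_of_subset_of_ncard_le (Set.subset_univ _)
    rw [Set.ncard_univ, h3, Nat.card_coe_set_eq]
  have h5 : (⟨y, hy⟩ : K) ∈ MulAction.fixedPoints P K := by rw [h4]; trivial
  have h6 : x * y * x⁻¹ = y := congrArg Subtype.val (h5 ⟨x, hx⟩)
  exact mul_inv_eq_iff_eq_mul.1 h6

/-- adjacency with `61` in the prime graph -/
def Adj (G : Type*) [Group G] (q : ℕ) : Prop := q.Prime ∧ q ≠ 61 ∧ ∃ g : G, orderOf g = 61 * q

/-- at most two neighbours -/
def Few (G : Type*) [Group G] : Prop := ∀ a b c : ℕ, Adj G a → Adj G b → Adj G c →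
  a ≠ b → a ≠ c → b ≠ c → False

theorem p61 : Nat.Prime 61 := by norm_num

instance : Fact (Nat.Prime 61) := ⟨p61⟩

theorem adj_of {q : ℕ} (hq : q.Prime) (hq61 : q ≠ 61) {x y : G} (hx : orderOf x = q) (hy : orderOf y = 61)
    (h : x * y = y * x) : Adj G q := by
  refine ⟨hq, hq61, y * x, ?_⟩
  have hc : Commute y x := h.symm
  rw [hc.orderOf_mul_eq_mul_orderOf_of_coprime, hx, hy]
  rw [hx, hy]
  exact (Nat.coprime_primes p61 hq).2 (Ne.symm hq61)

theorem lemL {q : ℕ} (hq : q.Prime) (hq61 : q ≠ 61) {P Q : Subgroup G} (hP : IsPGroup 61 P)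
    (hQ : IsPGroup q Q) (hQP : Q ≤ normalizer (P : Set G)) (hd : ¬ Nat.card Q ∣ Nat.card P - 1) : Adj G q := by
  have := Fact.mk hq
  by_contra hno
  apply hd
  let act := conjActOn Q P hQP
  let act2 : MulAction Q {x : P // x ≠ 1} := 
    { smul := fun g x => ⟨g • x.1, by
        intro h
        apply x.2
        have h1 : (g : G) * x.1 * (g : G)⁻¹ = 1 := congrArg Subtype.val h
        have h2 : (x.1 : G) = 1 := by
          have : (x.1 : G) = (g : G)⁻¹ * ((g : G) * x.1 * (g : G)⁻¹) * g := by group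
          rw [this, h1]; group
        exact Subtype.ext h2⟩
      one_smul := fun x => Subtype.ext (one_smul _ _)
      mul_smul := fun g h x => Subtype.ext (mul_smul _ _ _) }
  have hc : Nat.card {x : P // x ≠ 1} = Nat.card P - 1 := by
    have h1 : Nat.card {x : P // x ≠ 1} = ({1}ᶜ : Set P).ncard := by
      rw [← Nat.card_coe_set_eq]; rfl
    rw [h1, Set.ncard_compl, Set.ncard_singleton]
  rw [← hc]
  apply dvd_card_of_orbits (Q := Q)
  intro y
  have h1 := Nat.card_congr (MulAction.orbitProdStabilizerEquivGroup Q y)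
  rw [Nat.card_prod] at h1
  have h2 : Nat.card (MulAction.stabilizer Q y) = 1 := by
    by_contra hne
    have h3 : IsPGroup q (MulAction.stabilizer Q y) := hQ.to_subgroup _
    obtain ⟨n, hn⟩ := IsPGroup.iff_card.1 h3
    have hn0 : n ≠ 0 := by rintro rfl; exact hne (by simpa using hn)
    have hdv : q ∣ Nat.card (MulAction.stabilizer Q y) := by rw [hn]; exact dvd_pow_self q hn0
    obtain ⟨x, hx⟩ := exists_prime_orderOf_dvd_card' q hdv
    have hx' : orderOf (x : Q).1 = q := by rw [← hx]; simp
    have hxy : (x : Q).1 * (y.1 : G) * (x : Q).1⁻¹ = y.1 := 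
      congrArg (fun t : {x : P // x ≠ 1} => (t.1 : G)) x.2
    obtain ⟨k, hk⟩ := IsPGroup.iff_orderOf.1 hP y.1
    have hk0 : k ≠ 0 := by
      rintro rfl
      rw [pow_zero, orderOf_eq_one_iff] at hk
      exact y.2 hk
    have hdv2 : 61 ∣ orderOf (y.1 : G) := by
      rw [Subgroup.orderOf_coe, hk]; exact dvd_pow_self 61 hk0
    have ho := orderOf_pow_orderOf_div (orderOf_pos (y.1 : G)).ne' hdv2
    refine hno (adj_of hq hq61 hx' ho ?_)
    have c : Commute (x : Q).1 (y.1 : G) := mul_inv_eq_iff_eq_mul.1 hxy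
    exact c.pow_right _
  rw [h2, mul_one] at h1
  rw [h1]

theorem dec {n : ℕ} (h : n ∣ 2 ^ 5 * 3 ^ 2 * 5 ^ 2 * 13 * 31 * 97) :
    ∃ a < 6, ∃ b < 3, ∃ c < 3, ∃ d < 2, ∃ e < 2, ∃ f < 2,
      n = 2 ^ a * 3 ^ b * 5 ^ c * 13 ^ d * 31 ^ e * 97 ^ f := by
  obtain ⟨n5, m97, g5, h97, rfl⟩ := (Nat.dvd_mul.1 h)
  obtain ⟨n4, m31, g4, h31, rfl⟩ := (Nat.dvd_mul.1 g5)
  obtain ⟨n3, m13, g3, h13, rfl⟩ := (Nat.dvd_mul.1 g4)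
  obtain ⟨n2, m5, g2, h5, rfl⟩ := (Nat.dvd_mul.1 g3)
  obtain ⟨m2, m3, h2, h3, rfl⟩ := (Nat.dvd_mul.1 g2)
  obtain ⟨a, ha, rfl⟩ := (Nat.dvd_prime_pow (by norm_num)).1 h2
  obtain ⟨b, hb, rfl⟩ := (Nat.dvd_prime_pow (by norm_num)).1 h3
  obtain ⟨c, hc, rfl⟩ := (Nat.dvd_prime_pow (by norm_num)).1 h5
  rw [← pow_one 13] at h13
  rw [← pow_one 31] at h31
  rw [← pow_one 97] at h97
  obtain ⟨d, hd, rfl⟩ := (Nat.dvd_prime_pow (by norm_num)).1 h13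
  obtain ⟨e, he, rfl⟩ := (Nat.dvd_prime_pow (by norm_num)).1 h31
  obtain ⟨f, hf, rfl⟩ := (Nat.dvd_prime_pow (by norm_num)).1 h97
  exact ⟨a, by omega, b, by omega, c, by omega, d, by omega, e, by omega, f, by omega, rfl⟩

set_option maxRecDepth 100000 in
set_option maxHeartbeats 2000000 in
theorem dec2 : ∀ (a : Fin 6) (b c : Fin 3) (d e f : Fin 2),
      (2 ^ a.1 * 3 ^ b.1 * 5 ^ c.1 * 13 ^ d.1 * 31 ^ e.1 * 97 ^ f.1) % 61 = 1 →
      2 ^ a.1 * 3 ^ b.1 * 5 ^ c.1 * 13 ^ d.1 * 31 ^ e.1 * 97 ^ f.1 ∈ [1,62,3600,3783,9700,223200,234546,601400] := by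
  decide +kernel

theorem nlist {n : ℕ} (h : n ∣ 2 ^ 5 * 3 ^ 2 * 5 ^ 2 * 13 * 31 * 97) (h1 : n ≡ 1 [MOD 61]) :
    n ∈ [1,62,3600,3783,9700,223200,234546,601400] := by
  obtain ⟨a, ha, b, hb, c, hc, d, hd, e, he, f, hf, rfl⟩ := dec h
  exact dec2 ⟨a, ha⟩ ⟨b, hb⟩ ⟨c, hc⟩ ⟨d, hd⟩ ⟨e, he⟩ ⟨f, hf⟩ h1

theorem sylow_mul (S : Sylow p G) :
    Nat.card (Sylow p G) * Nat.card (normalizer (S : Set G)) = Nat.card G := by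
  rw [Sylow.card_eq_index_normalizer S, mul_comm]
  exact Subgroup.card_mul_index _

/-- 61-Sylow numbers of groups of order dividing ours. -/
theorem sylow_list {X : Type*} [Group X] [Finite X] 
    (hX : Nat.card X ∣ 2 ^ 5 * 3 ^ 2 * 5 ^ 2 * 13 * 31 * 61 ^ 3 * 97) :
    Nat.card (Sylow 61 X) ∈ [1,62,3600,3783,9700,223200,234546,601400] := by
  have h1 := card_sylow_modEq_one 61 X
  apply nlist _ h1
  obtain ⟨S⟩ := (inferInstance : Nonempty (Sylow 61 X))
  have h2 : Nat.card (Sylow 61 X) ∣ Nat.card X := ⟨_, (sylow_mul S).symm⟩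
  have h3 := h2.trans hX
  rw [show 2 ^ 5 * 3 ^ 2 * 5 ^ 2 * 13 * 31 * 61 ^ 3 * 97 = 61 ^ 3 * (2 ^ 5 * 3 ^ 2 * 5 ^ 2 * 13 * 31 * 97) by norm_num] at h3
  refine Nat.Coprime.dvd_of_dvd_mul_left ?_ h3
  apply Nat.Coprime.pow_right
  have h4 := h1.gcd_eq
  rw [Nat.gcd_one_left] at h4
  exact h4

theorem card_syl (hcard : Nat.card G = 2 ^ 5 * 3 ^ 2 * 5 ^ 2 * 13 * 31 * 61 ^ 3 * 97) (S : Sylow 61 G) :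
    Nat.card S = 61 ^ 3 := by
  apply Nat.dvd_antisymm
  · obtain ⟨n, hn⟩ := IsPGroup.iff_card.1 S.isPGroup'
    have h1 : Nat.card S ∣ Nat.card G := Subgroup.card_subgroup_dvd_card _
    rw [hn] at h1 ⊢
    rw [hcard] at h1
    apply pow_dvd_pow
    by_contra hlt
    have h2 : 61 ^ 4 ∣ 61 ^ n := pow_dvd_pow _ (by omega)
    have h3 := h2.trans h1
    norm_num at h3
  · apply S.pow_dvd_card_of_pow_dvd_card
    rw [hcard]; norm_num

theorem exists_sub {K : Subgroup G} (q k : ℕ) (hq : q.Prime) (h : q ^ k ∣ Nat.card K) :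
    ∃ Q : Subgroup G, Q ≤ K ∧ Nat.card Q = q ^ k := by
  have := Fact.mk hq
  obtain ⟨Q, hQ⟩ := Sylow.exists_subgroup_card_pow_prime q h
  refine ⟨Q.map K.subtype, map_subtype_le _, ?_⟩
  rw [← hQ]
  exact (Nat.card_congr (Q.equivMapOfInjective _ K.subtype_injective).toEquiv).symm

/-- a big normalizer of a 61-subgroup gives adjacency. -/
theorem adj_norm {P : Subgroup G} (hP : IsPGroup 61 P) (q k : ℕ) (hq : q.Prime) (hq61 : q ≠ 61)
    (h : q ^ k ∣ Nat.card (normalizer (P : Set G))) (hd : ¬ q ^ k ∣ Nat.card P - 1) : Adj G q := by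
  have := Fact.mk hq
  obtain ⟨Q, hQ, hc⟩ := exists_sub q k hq h
  refine lemL hq hq61 hP (IsPGroup.of_card hc) hQ ?_
  rw [hc]; exact hd

theorem n_ne (hcard : Nat.card G = 2 ^ 5 * 3 ^ 2 * 5 ^ 2 * 13 * 31 * 61 ^ 3 * 97) (hF : Few G) :
    Nat.card (Sylow 61 G) ≠ 1 ∧ Nat.card (Sylow 61 G) ≠ 3783 := by
  obtain ⟨S⟩ := (inferInstance : Nonempty (Sylow 61 G))
  have h1 := sylow_mul S
  have key : 2 ^ 5 ∣ Nat.card (normalizer (S : Set G)) → 5 ^ 2 ∣ Nat.card (normalizer (S : Set G)) →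
    31 ^ 1 ∣ Nat.card (normalizer (S : Set G)) → False := by
    intro a b c
    have hP := S.isPGroup'
    refine hF 2 5 31 (adj_norm hP 2 5 (by norm_num) (by norm_num) a ?_) 
      (adj_norm hP 5 2 (by norm_num) (by norm_num) b ?_) 
      (adj_norm hP 31 1 (by norm_num) (by norm_num) c ?_) (by norm_num) (by norm_num) (by norm_num)
    all_goals (rw [card_syl hcard S]; norm_num)
  rw [hcard] at h1
  constructor
  · intro h
    rw [h, one_mul] at h1
    rw [h1] at key
    exact key (by norm_num) (by norm_num) (by norm_num)
  · intro h
    rw [h] at h1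
    have h2 : Nat.card (normalizer (S : Set G)) = 2 ^ 5 * 3 * 5 ^ 2 * 31 * 61 ^ 3 := by omega
    rw [h2] at key
    exact key (by norm_num) (by norm_num) (by norm_num)

theorem exists_D (hcard : Nat.card G = 2 ^ 5 * 3 ^ 2 * 5 ^ 2 * 13 * 31 * 61 ^ 3 * 97) (hF : Few G) :
    ∃ S T : Sylow 61 G, S ≠ T ∧ Nat.card (S ⊓ T : Subgroup G) = 61 ^ 2 := by
  by_contra hcon
  push Not at hcon
  have hcS := card_syl hcard
  obtain ⟨S⟩ := (inferInstance : Nonempty (Sylow 61 G))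
  have hsm : ∀ T : Sylow 61 G, T ≠ S → 61 ^ 2 ∣ Nat.card (MulAction.orbit S T) := by
    intro T hT
    have h1 := Nat.card_congr (MulAction.orbitProdStabilizerEquivGroup S T)
    rw [Nat.card_prod] at h1
    have h2 : Nat.card (MulAction.stabilizer S T) = Nat.card (S ⊓ T : Subgroup G) := by
      rw [← S.isPGroup'.inf_normalizer_sylow T]
      refine Nat.card_congr ⟨fun k => ⟨k.1.1, k.1.2, ?_⟩, fun k => ⟨⟨k.1, k.2.1⟩, ?_⟩, fun _ => rfl, fun _ => rfl⟩
      · have h3 : (k.1.1 : G) • T = T := k.2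
        exact Sylow.smul_eq_iff_mem_normalizer.1 h3
      · have h3 := Sylow.smul_eq_iff_mem_normalizer.2 k.2.2
        exact h3
    have h3 : Nat.card (S ⊓ T : Subgroup G) ∣ 61 ^ 3 := by
      rw [← hcS S]; exact card_dvd_of_le inf_le_left
    obtain ⟨i, hi, hi2⟩ := (Nat.dvd_prime_pow p61).1 h3
    have hi3 : i ≠ 3 := by
      rintro rfl
      have e1 : (S ⊓ T : Subgroup G) = S := Subgroup.eq_of_le_of_card_ge inf_le_left (by rw [hi2, hcS])
      have e2 : (S ⊓ T : Subgroup G) = T := Subgroup.eq_of_le_of_card_ge inf_le_right (by rw [hi2, hcS])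
      exact hT (Sylow.ext (e2.symm.trans e1))
    have hi4 : i ≠ 2 := by
      rintro rfl
      exact hcon S T (Ne.symm hT) hi2
    rw [h2, hi2, hcS] at h1
    have : i ≤ 1 := by omega
    interval_cases i
    · exact ⟨61, by omega⟩
    · exact ⟨1, by omega⟩
  let act2 : MulAction S {T : Sylow 61 G // T ≠ S} :=
    { smul := fun g x => ⟨(g : G) • x.1, by
        intro h
        apply x.2
        have h1 : (g : G) • S = S := 
          Sylow.smul_eq_iff_mem_normalizer.2 (le_normalizer g.2)
        have h2 : (g : G) • x.1 = (g : G) • S := h.trans h1.symm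
        exact smul_left_cancel _ h2⟩
      one_smul := fun x => Subtype.ext (one_smul _ _)
      mul_smul := fun g h x => Subtype.ext (mul_smul (g : G) (h : G) _) }
  have hdv : 61 ^ 2 ∣ Nat.card {T : Sylow 61 G // T ≠ S} := by
    apply dvd_card_of_orbits (Q := S)
    intro T
    have e : Nat.card (MulAction.orbit S T) = Nat.card (MulAction.orbit S T.1) := by
      refine Nat.card_congr (Equiv.ofBijective (fun x => ⟨x.1.1, ?_⟩) ⟨?_, ?_⟩)
      · obtain ⟨g, hg⟩ := x.2
        exact ⟨g, congrArg Subtype.val hg⟩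
      · intro x y h
        exact Subtype.ext (Subtype.ext (congrArg (fun t : MulAction.orbit S T.1 => t.1) h))
      · rintro ⟨x, g, hg⟩
        exact ⟨⟨g • T, ⟨g, rfl⟩⟩, Subtype.ext hg⟩
    rw [e]
    exact hsm T.1 T.2
  have hc : Nat.card {T : Sylow 61 G // T ≠ S} = Nat.card (Sylow 61 G) - 1 := by
    have h1 : Nat.card {T : Sylow 61 G // T ≠ S} = ({S}ᶜ : Set (Sylow 61 G)).ncard := by
      rw [← Nat.card_coe_set_eq]; rfl
    rw [h1, Set.ncard_compl, Set.ncard_singleton]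
  rw [hc] at hdv
  have h1 := sylow_list (X := G) (by rw [hcard])
  have h2 := (n_ne hcard hF).1
  simp only [List.mem_cons, List.not_mem_nil, or_false] at h1
  rcases h1 with h | h | h | h | h | h | h | h <;> rw [h] at hdv h2 <;> revert hdv h2 <;> norm_num

theorem no62 {X : Type*} [Group X] [Finite X] (hdvd : Nat.card X ∣ 2 ^ 5 * 31 * 61 ^ 3)
    (D : Subgroup X) [D.Normal] (hD : Nat.card D = 61 ^ 2) (j : ℕ)
    (hC : (centralizer (D : Set X)).index ∣ 61 ^ j) (h61 : 61 ^ 3 ∣ Nat.card X)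
    (hn : Nat.card (Sylow 61 X) = 62) : False := by
  have f31 : Fact (Nat.Prime 31) := ⟨by norm_num⟩
  obtain ⟨S⟩ := (inferInstance : Nonempty (Sylow 61 X))
  have h31 : 31 ∣ Nat.card X := by
    refine Dvd.dvd.trans ?_ (⟨_, (sylow_mul S).symm⟩ : Nat.card (Sylow 61 X) ∣ Nat.card X)
    rw [hn]; norm_num
  obtain ⟨R⟩ := (inferInstance : Nonempty (Sylow 31 X))
  have hR : Nat.card R = 31 := by
    obtain ⟨n, hn⟩ := IsPGroup.iff_card.1 R.isPGroup'
    have h1 : Nat.card R ∣ 2 ^ 5 * 31 * 61 ^ 3 := (Subgroup.card_subgroup_dvd_card _).trans hdvd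
    have h2 := R.dvd_card_of_dvd_card h31
    rw [hn] at h1 h2 ⊢
    have hlt : n < 2 := by
      by_contra hlt
      have h2 : 31 ^ 2 ∣ 31 ^ n := pow_dvd_pow _ (by omega)
      have h3 := h2.trans h1
      norm_num at h3
    interval_cases n
    · norm_num at h2
    · norm_num
  have hRC : (R : Subgroup X) ≤ centralizer (D : Set X) := by
    intro r hr
    have h1 : r ^ 31 = 1 := by
      have : (⟨r, hr⟩ : R) ^ Nat.card R = 1 := pow_card_eq_one'
      rw [hR] at this
      exact congrArg Subtype.val this
    have h2 : r ^ (61 ^ j) ∈ centralizer (D : Set X) := by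
      obtain ⟨c, hc⟩ := hC
      rw [hc, pow_mul]
      exact pow_mem (pow_index_mem _ r) c
    have h3 : Nat.Coprime (orderOf r) (61 ^ j) := by
      apply Nat.Coprime.pow_right
      have : orderOf r ∣ 31 := orderOf_dvd_of_pow_eq_one h1
      exact Nat.Coprime.coprime_dvd_left this (by norm_num)
    obtain ⟨m, hm⟩ := exists_pow_eq_self_of_coprime h3.symm
    rw [← hm]
    exact pow_mem h2 m
  have hDN : D ≤ normalizer (R : Set X) := by
    intro d hd
    apply mem_norm_of
    intro r hr
    have := mem_centralizer_iff.1 (hRC hr) d hd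
    rw [this, mul_inv_cancel_right]
    exact hr
  have hRN : (R : Subgroup X) ≤ normalizer (R : Set X) := le_normalizer
  have d1 : 61 ^ 2 ∣ Nat.card (normalizer (R : Set X)) := by rw [← hD]; exact card_dvd_of_le hDN
  have d2 : 31 ∣ Nat.card (normalizer (R : Set X)) :=
    (dvd_of_eq hR.symm).trans (card_dvd_of_le hRN)
  have d3 : 31 * 61 ^ 2 ∣ Nat.card (normalizer (R : Set X)) :=
    Nat.Coprime.mul_dvd_of_dvd_of_dvd (by norm_num) d2 d1
  have hm := sylow_mul R
  have hmod := card_sylow_modEq_one 31 X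
  have d4 : 61 ^ 3 ∣ Nat.card (normalizer (R : Set X)) := by
    obtain ⟨c, hc⟩ := d3
    have h1 : Nat.card (Sylow 31 X) ∣ 1952 := by
      have h2 : Nat.card (Sylow 31 X) * (31 * 61 ^ 2) ∣ 1952 * (31 * 61 ^ 2) := by
        refine Dvd.dvd.trans ⟨c, ?_⟩ ((dvd_of_eq hm).trans (hdvd.trans (by norm_num)))
        rw [hc]; ring
      exact Nat.dvd_of_mul_dvd_mul_right (by norm_num) h2
    have h2 : Nat.Coprime (61 ^ 3) (Nat.card (Sylow 31 X)) := by
      apply Nat.Coprime.pow_left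
      rw [Nat.Prime.coprime_iff_not_dvd p61]
      rintro ⟨e, he⟩
      rw [he] at h1 hmod
      have h3 : e ∣ 2 ^ 5 := by
        have : 61 * e ∣ 61 * 2 ^ 5 := by norm_num; exact h1
        exact Nat.dvd_of_mul_dvd_mul_left (by norm_num) this
      obtain ⟨i, hi, rfl⟩ := (Nat.dvd_prime_pow Nat.prime_two).1 h3
      unfold Nat.ModEq at hmod
      interval_cases i <;> norm_num at hmod
    refine h2.dvd_of_dvd_mul_left ?_
    rw [hm]; exact h61
  obtain ⟨Q, hQN, hQ⟩ := exists_sub 61 3 p61 d4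
  have hQp : IsPGroup 61 Q := IsPGroup.of_card hQ
  obtain ⟨Q', hQ'⟩ := hQp.exists_le_sylow
  have hQQ : Q = Q' := by
    apply Subgroup.eq_of_le_of_card_ge hQ'
    rw [hQ]
    obtain ⟨n, hn⟩ := IsPGroup.iff_card.1 Q'.isPGroup'
    have h1 : Nat.card Q' ∣ 2 ^ 5 * 31 * 61 ^ 3 := (Subgroup.card_subgroup_dvd_card _).trans hdvd
    rw [hn] at h1 ⊢
    apply Nat.pow_le_pow_right (by norm_num)
    by_contra hlt
    have h2 : 61 ^ 4 ∣ 61 ^ n := pow_dvd_pow _ (by omega)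
    have h3 := h2.trans h1
    norm_num at h3
  have hRQ : (R : Subgroup X) ≤ normalizer (Q' : Set X) := by
    intro r hr
    apply mem_norm_of
    intro x hx
    have hx' : x ∈ Q := by rw [hQQ]; exact hx
    have := fixall hQp hQN (by rw [hR]; norm_num) hx' hr
    rw [← this, mul_inv_cancel_right]
    exact hx
  have d5 : 31 ∣ Nat.card (normalizer (Q' : Set X)) := 
    (dvd_of_eq hR.symm).trans (card_dvd_of_le hRQ)
  have h6 := sylow_mul Q'
  rw [hn] at h6
  obtain ⟨c, hc⟩ := d5
  have h7 : 62 * 31 ∣ 2 ^ 5 * 31 * 61 ^ 3 := by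
    refine Dvd.dvd.trans ⟨c, ?_⟩ hdvd
    rw [← h6, hc]; ring
  norm_num at h7

end num
end ODL3


namespace ODL3

set_option linter.unusedSectionVars false

open Subgroup

section fin
variable {G : Type*} [Group G] [Finite G]

theorem few_sub (hF : Few G) (X : Subgroup G) : Few X := by
  intro a b c ha hb hc
  have : ∀ q, Adj X q → Adj G q := by
    rintro q ⟨h1, h2, g, hg⟩
    exact ⟨h1, h2, g, by rw [orderOf_coe]; exact hg⟩
  exact hF a b c (this _ ha) (this _ hb) (this _ hc)

theorem lemX0 (hcard : Nat.card G ∣ 2 ^ 5 * 3 ^ 2 * 5 ^ 2 * 13 * 31 * 61 ^ 3 * 97) (hF : Few G)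
    (D : Subgroup G) [D.Normal] (hD : Nat.card D = 61 ^ 2) (A : Subgroup G) (hA : Nat.card A = 61 ^ 3)
    (h : A ⊔ centralizer (D : Set G) = ⊤) : Nat.card (Sylow 61 G) = 1 := by
  have hi : (centralizer (D : Set G)).index ∣ 61 ^ 3 := by
    rw [← hA, ← relIndex_top_right, ← h, relIndex_sup_right]
    exact relIndex_dvd_card _ _
  obtain ⟨d, hd⟩ := exists_prime_orderOf_dvd_card' (G := D) 61 (by rw [hD]; norm_num)
  have hadj : ∀ q : ℕ, q.Prime → q ≠ 61 → q ∣ Nat.card G → Adj G q := by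
    intro q hq hq61 hqG
    have := Fact.mk hq
    rw [← card_mul_index (centralizer (D : Set G))] at hqG
    rcases (Nat.Prime.dvd_mul hq).1 hqG with h1 | h1
    · obtain ⟨c, hc⟩ := exists_prime_orderOf_dvd_card' (G := centralizer (D : Set G)) q h1
      refine adj_of hq hq61 (x := (c : G)) (y := (d : G)) (by rw [orderOf_coe, hc]) (by rw [orderOf_coe, hd]) ?_
      exact (mem_centralizer_iff.1 c.2 d d.2).symm
    · exact absurd ((Nat.prime_dvd_prime_iff_eq hq p61).1 (hq.dvd_of_dvd_pow (h1.trans hi))) hq61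
  obtain ⟨S⟩ := (inferInstance : Nonempty (Sylow 61 G))
  have hnG : Nat.card (Sylow 61 G) ∣ Nat.card G := ⟨_, (sylow_mul S).symm⟩
  have hl := sylow_list hcard
  have key : ∀ a b c : ℕ, a.Prime → b.Prime → c.Prime → a ≠ 61 → b ≠ 61 → c ≠ 61 → a ≠ b → a ≠ c → b ≠ c →
      a ∣ Nat.card G → b ∣ Nat.card G → c ∣ Nat.card G → False := by
    intro a b c pa pb pc na nb nc hab hac hbc da db dc
    exact hF a b c (hadj a pa na da) (hadj b pb nb db) (hadj c pc nc dc) hab hac hbc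
  simp only [List.mem_cons, List.not_mem_nil, or_false] at hl
  rcases hl with hl | hl | hl | hl | hl | hl | hl | hl <;> rw [hl] at hnG
  · exact hl
  · exfalso
    have h2 : 2 ∣ Nat.card G := Dvd.dvd.trans (by norm_num) hnG
    have h31 : 31 ∣ Nat.card G := Dvd.dvd.trans (by norm_num) hnG
    have cop : ∀ q : ℕ, q.Prime → q ≠ 61 → q ≠ 2 → q ≠ 31 → Nat.Coprime (Nat.card G) q := by
      intro q hq h1 h3 h4
      rw [Nat.coprime_comm, hq.coprime_iff_not_dvd]
      intro h5
      exact key 2 31 q (by norm_num) (by norm_num) hq (by norm_num) (by norm_num) h1 (by norm_num) h3.symm h4.symm h2 h31 h5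
    refine no62 (X := G) ?_ D hD 3 hi ?_ hl
    · have c3 := (cop 3 (by norm_num) (by norm_num) (by norm_num) (by norm_num)).pow_right 2
      have c5 := (cop 5 (by norm_num) (by norm_num) (by norm_num) (by norm_num)).pow_right 2
      have c13 := cop 13 (by norm_num) (by norm_num) (by norm_num) (by norm_num)
      have c97 := cop 97 (by norm_num) (by norm_num) (by norm_num) (by norm_num)
      refine Nat.Coprime.dvd_of_dvd_mul_right (((c3.mul_right c5).mul_right c13).mul_right c97) ?_
      refine hcard.trans (dvd_of_eq (by norm_num))
    · rw [← hA]; exact card_subgroup_dvd_card _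
  all_goals exfalso
  · exact key 2 3 5 (by norm_num) (by norm_num) (by norm_num) (by norm_num) (by norm_num) (by norm_num) (by norm_num) (by norm_num) (by norm_num)
      (Dvd.dvd.trans (by norm_num) hnG) (Dvd.dvd.trans (by norm_num) hnG) (Dvd.dvd.trans (by norm_num) hnG)
  · exact key 3 13 97 (by norm_num) (by norm_num) (by norm_num) (by norm_num) (by norm_num) (by norm_num) (by norm_num) (by norm_num) (by norm_num)
      (Dvd.dvd.trans (by norm_num) hnG) (Dvd.dvd.trans (by norm_num) hnG) (Dvd.dvd.trans (by norm_num) hnG)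
  · exact key 2 5 97 (by norm_num) (by norm_num) (by norm_num) (by norm_num) (by norm_num) (by norm_num) (by norm_num) (by norm_num) (by norm_num)
      (Dvd.dvd.trans (by norm_num) hnG) (Dvd.dvd.trans (by norm_num) hnG) (Dvd.dvd.trans (by norm_num) hnG)
  · exact key 2 3 5 (by norm_num) (by norm_num) (by norm_num) (by norm_num) (by norm_num) (by norm_num) (by norm_num) (by norm_num) (by norm_num)
      (Dvd.dvd.trans (by norm_num) hnG) (Dvd.dvd.trans (by norm_num) hnG) (Dvd.dvd.trans (by norm_num) hnG)
  · exact key 2 3 13 (by norm_num) (by norm_num) (by norm_num) (by norm_num) (by norm_num) (by norm_num) (by norm_num) (by norm_num) (by norm_num)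
      (Dvd.dvd.trans (by norm_num) hnG) (Dvd.dvd.trans (by norm_num) hnG) (Dvd.dvd.trans (by norm_num) hnG)
  · exact key 2 5 31 (by norm_num) (by norm_num) (by norm_num) (by norm_num) (by norm_num) (by norm_num) (by norm_num) (by norm_num) (by norm_num)
      (Dvd.dvd.trans (by norm_num) hnG) (Dvd.dvd.trans (by norm_num) hnG) (Dvd.dvd.trans (by norm_num) hnG)

theorem lemX (hcard : Nat.card G = 2 ^ 5 * 3 ^ 2 * 5 ^ 2 * 13 * 31 * 61 ^ 3 * 97) (hF : Few G)
    (D : Subgroup G) (hD : Nat.card D = 61 ^ 2) (S : Sylow 61 G) (hS : D ≤ S) :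
    centralizer (D : Set G) ≤ normalizer (S : Set G) := by
  have hcS := card_syl hcard S
  set X : Subgroup G := (S : Subgroup G) ⊔ centralizer (D : Set G) with hX
  have hSX : (S : Subgroup G) ≤ X := le_sup_left
  have hCX : centralizer (D : Set G) ≤ X := le_sup_right
  have hDX : D ≤ X := hS.trans hSX
  have hXN : X ≤ normalizer (D : Set G) :=
    sup_le (le_normalizer_sq hcS hD hS) (centralizer_le_normalizer _)
  have hn : (D.subgroupOf X).Normal := (normal_subgroupOf_iff_le_normalizer hDX).2 hXN
  have h1 : Nat.card (Sylow 61 X) = 1 := by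
    refine lemX0 (G := X) (hcard ▸ card_subgroup_dvd_card X) (few_sub hF X) (D.subgroupOf X) ?_
      ((S : Subgroup G).subgroupOf X) ?_ ?_
    · rw [← hD]; exact Nat.card_congr (subgroupOfEquivOfLe hDX).toEquiv
    · rw [← hcS]; exact Nat.card_congr (subgroupOfEquivOfLe hSX).toEquiv
    · have : (centralizer (D : Set G)).subgroupOf X ≤ centralizer ((D.subgroupOf X : Subgroup X) : Set X) := by
        intro x hx
        refine mem_centralizer_iff.2 fun y hy => Subtype.ext ?_
        exact mem_centralizer_iff.1 (mem_subgroupOf.1 hx) y (mem_subgroupOf.1 hy)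
      rw [eq_top_iff]
      refine le_trans ?_ (sup_le_sup_left this _)
      rw [← subgroupOf_sup hSX hCX, ← hX, subgroupOf_self]
  have : Subsingleton (Sylow 61 X) := (Nat.card_eq_one_iff_unique.1 h1).1
  have hN : ((S.subtype hSX : Sylow 61 X) : Subgroup X).Normal := Sylow.normal_of_subsingleton _
  rw [Sylow.coe_subtype] at hN
  exact hCX.trans ((normal_subgroupOf_iff_le_normalizer hSX).1 hN)

end fin
end ODL3


namespace ODL3

set_option linter.unusedSectionVars false

open Subgroup

section fin2
variable {G : Type*} [Group G] [Finite G]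

theorem orbit_all {D : Subgroup G} {S T : Sylow 61 G} (hST : S ≠ T) (hDS : D = (S ⊓ T : Subgroup G))
    (h : Nat.card (normalizer (D : Set G)) =
      62 * Nat.card (normalizer (D : Set G) ⊓ normalizer (S : Set G) : Subgroup G))
    (hn : Nat.card (Sylow 61 G) = 62) : normalizer (D : Set G) = ⊤ := by
  have h1 := Nat.card_congr (MulAction.orbitProdStabilizerEquivGroup (normalizer (D : Set G)) S)
  rw [Nat.card_prod, h] at h1
  have h2 : Nat.card (MulAction.stabilizer (normalizer (D : Set G)) S) =
      Nat.card (normalizer (D : Set G) ⊓ normalizer (S : Set G) : Subgroup G) := by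
    refine Nat.card_congr ⟨fun k => ⟨k.1.1, k.1.2, ?_⟩, fun k => ⟨⟨k.1, k.2.1⟩, ?_⟩, fun _ => rfl, fun _ => rfl⟩
    · exact Sylow.smul_eq_iff_mem_normalizer.1 k.2
    · exact Sylow.smul_eq_iff_mem_normalizer.2 k.2.2
  rw [h2] at h1
  have h3 := Nat.eq_of_mul_eq_mul_right Nat.card_pos h1
  have h4 : MulAction.orbit (normalizer (D : Set G)) S = Set.univ := by
    refine Set.eq_of_subset_of_ncard_le (Set.subset_univ _) ?_ (Set.toFinite _)
    rw [Set.ncard_univ, hn, ← Nat.card_coe_set_eq, h3]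
  have h5 : ∀ P : Sylow 61 G, D ≤ P := by
    intro P x hx
    obtain ⟨g, rfl⟩ : P ∈ MulAction.orbit (normalizer (D : Set G)) S := h4 ▸ Set.mem_univ _
    refine mem_smul_sylow (S := S) (g := (g : G)).2 ?_
    have h6 : ((g : G)⁻¹ * x * g) ∈ D := by
      have := (mem_normalizer_iff.1 (inv_mem g.2) x).1 hx
      simpa using this
    exact ((le_of_eq hDS).trans inf_le_left) h6
  rw [eq_top_iff]
  intro g _
  refine mem_norm_of fun d hd => ?_
  have h7 : ∀ P : Sylow 61 G, g * d * g⁻¹ ∈ P := by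
    intro P
    have := mem_smul_sylow.1 (h5 (g⁻¹ • P) hd)
    simpa using this
  rw [hDS]
  exact ⟨h7 S, h7 T⟩

theorem numfact : ∀ f : Fin 21, ∀ k : Fin 21, 1 ≤ k.1 → k.1 < f.1 → f.1 ∣ 20 → 
    ¬ (60 / Nat.gcd 60 (3 * k.1)) ∣ 20 / f.1 := by decide

theorem step4 (hcard : Nat.card G = 2 ^ 5 * 3 ^ 2 * 5 ^ 2 * 13 * 31 * 61 ^ 3 * 97) (hF : Few G) :
    ∃ (D : Subgroup G) (S T : Sylow 61 G) (E : ZMod 61 × ZMod 61 → G), Nat.card D = 61 ^ 2 ∧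
      Loc 61 D S T E ∧ normalizer (S : Set G) ≤ normalizer (D : Set G) ∧
      (normalizer (D : Set G)).index = 3783 := by
  obtain ⟨S, T, hST, hD⟩ := exists_D hcard hF
  have hcS := card_syl hcard
  obtain ⟨D, hDe⟩ : ∃ D : Subgroup G, D = (S ⊓ T : Subgroup G) := ⟨_, rfl⟩
  rw [← hDe] at hD
  obtain ⟨E, H⟩ := exists_loc (D := D) (S := S) (T := T) hcS hD (hDe ▸ inf_le_left) (hDe ▸ inf_le_right) hST
    (fun S' h => lemX hcard hF D hD S' h)
  refine ⟨D, S, T, E, hD, H, ?_⟩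
  have hu : 61 ^ 3 * (61 - 1) ∣ Nat.card (normalizer (D : Set G) ⊓ normalizer (S : Set G) : Subgroup G) :=
    H.dvdV le_rfl (H.leS_U hD) H.diag_U
  have hN := H.card_norm
  have hfu : Nat.card (normalizer (D : Set G) ⊓ normalizer (S : Set G) : Subgroup G) ∣
    Nat.card (normalizer (S : Set G)) := card_dvd_of_le inf_le_right
  have hfa := H.f_arg hD
  have hnm := sylow_mul S
  have hl := sylow_list (X := G) (dvd_of_eq hcard)
  have hne := n_ne hcard hF
  generalize hug : Nat.card (normalizer (D : Set G) ⊓ normalizer (S : Set G) : Subgroup G) = u at *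
  obtain ⟨v, rfl⟩ := hu
  obtain ⟨f, hf⟩ := hfu
  rw [hcard, hf] at hnm
  have hnfv : Nat.card (Sylow 61 G) * (v * f) = 4690920 := by
    have : 61 ^ 3 * 60 * (Nat.card (Sylow 61 G) * (v * f)) = 61 ^ 3 * 60 * 4690920 := by
      linarith
    exact Nat.eq_of_mul_eq_mul_left (by norm_num) this
  have hdv : Nat.card (Sylow 61 G) ∣ 4690920 := ⟨_, hnfv.symm⟩
  have hn : Nat.card (Sylow 61 G) = 62 ∨ Nat.card (Sylow 61 G) = 234546 := by
    simp only [List.mem_cons, List.not_mem_nil, or_false] at hl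
    rcases hl with hl | hl | hl | hl | hl | hl | hl | hl
    · exact absurd hl hne.1
    · exact Or.inl hl
    · rw [hl] at hdv; norm_num at hdv
    · exact absurd hl hne.2
    · rw [hl] at hdv; norm_num at hdv
    · rw [hl] at hdv; norm_num at hdv
    · exact Or.inr hl
    · rw [hl] at hdv; norm_num at hdv
  rcases hn with hn | hn
  · exfalso
    have htop := orbit_all hST hDe (by rw [hN, hug]) hn
    have hP : IsPGroup 61 D := IsPGroup.of_card hD
    have key : ∀ q k : ℕ, q.Prime → q ≠ 61 → q ^ k ∣ Nat.card G → ¬ q ^ k ∣ 61 ^ 2 - 1 → Adj G q := by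
      intro q k hq h61 h1 h2
      refine adj_norm hP q k hq h61 ?_ (by rwa [hD])
      rw [htop, card_top]; exact h1
    exact hF 13 97 5 (key 13 1 (by norm_num) (by norm_num) (by rw [hcard]; norm_num) (by norm_num))
      (key 97 1 (by norm_num) (by norm_num) (by rw [hcard]; norm_num) (by norm_num))
      (key 5 2 (by norm_num) (by norm_num) (by rw [hcard]; norm_num) (by norm_num))
      (by norm_num) (by norm_num) (by norm_num)
  · rw [hn] at hnfv
    have hfv : v * f = 20 := by omega
    have hle : normalizer (S : Set G) ≤ normalizer (D : Set G) := by
      by_contra hcon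
      obtain ⟨k, hk1, hk2, hk3⟩ := hfa hcon
      rw [hf, mul_comm k] at hk2
      have hkf : k < f := lt_of_mul_lt_mul_left hk2 (Nat.zero_le _)
      have hk4 : (61 - 1) / Nat.gcd (61 - 1) (3 * k) ∣ v := 
        Nat.dvd_of_mul_dvd_mul_left (by norm_num) hk3
      have hf20 : f ∣ 20 := ⟨v, by rw [← hfv, mul_comm]⟩
      have hfl := Nat.le_of_dvd (by norm_num) hf20
      refine numfact ⟨f, by omega⟩ ⟨k, by omega⟩ hk1 hkf hf20 ?_
      have : 20 / f = v := by rw [← hfv]; exact Nat.mul_div_cancel _ (by omega)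
      simpa [this] using hk4
    refine ⟨hle, ?_⟩
    have hu1 : Nat.card (normalizer (S : Set G)) = 61 ^ 3 * (61 - 1) * v := by
      rw [← hug, inf_eq_right.2 hle]
    have hf1 : f = 1 := by
      have hv : 0 < v := Nat.pos_of_ne_zero (by rintro rfl; omega)
      rw [hf] at hu1
      have hpos : 0 < 61 ^ 3 * (61 - 1) * v := Nat.mul_pos (by norm_num) hv
      exact Nat.eq_of_mul_eq_mul_left hpos (hu1.trans (mul_one _).symm)
    subst hf1
    have hv : v = 20 := by omega
    subst hv
    have h9 := card_mul_index (normalizer (D : Set G))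
    rw [hN, hcard] at h9
    norm_num at h9
    omega

/-- the subgroup attached to a coset -/
noncomputable def DL (D : Subgroup G) (l : G ⧸ normalizer (D : Set G)) : Subgroup G :=
  D.map (MulAut.conj l.out).toMonoidHom

theorem mem_DL {D : Subgroup G} {g x : G} : 
    x ∈ DL D (QuotientGroup.mk g) ↔ g⁻¹ * x * g ∈ D := by
  obtain ⟨n, hn⟩ := QuotientGroup.mk_out_eq_mul (normalizer (D : Set G)) g
  unfold DL
  rw [hn]
  constructor
  · rintro ⟨d, hd, rfl⟩
    have := (mem_normalizer_iff.1 n.2 d).1 hd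
    have e : g⁻¹ * ((MulAut.conj (g * (n : G))).toMonoidHom d) * g = n * d * (n : G)⁻¹ := by
      change g⁻¹ * (g * n * d * (g * n)⁻¹) * g = _
      group
    rw [e]; exact this
  · intro h
    refine ⟨(n : G)⁻¹ * (g⁻¹ * x * g) * n, ?_, ?_⟩
    · have := (mem_normalizer_iff.1 (inv_mem n.2) _).1 h
      simpa using this
    · change g * n * _ * (g * n)⁻¹ = x
      group

theorem od_main (hcard : Nat.card G = 2 ^ 5 * 3 ^ 2 * 5 ^ 2 * 13 * 31 * 61 ^ 3 * 97) (hF : Few G) :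
    Nonempty (G ≃* Matrix.ProjectiveSpecialLinearGroup (Fin 3) (ZMod 61)) := by
  obtain ⟨D, S, T, E, hD, H, hle, hi⟩ := step4 hcard hF
  have hDl : ∀ x, x ∈ DL D (QuotientGroup.mk 1) ↔ x ∈ D := by
    intro x; rw [mem_DL]; simp
  have hfix : ∀ (g x : G), g • (QuotientGroup.mk x : G ⧸ normalizer (D : Set G)) = QuotientGroup.mk x ↔
      x⁻¹ * g * x ∈ normalizer (D : Set G) := by
    intro g x
    rw [eq_comm, MulAction.Quotient.smul_mk, QuotientGroup.eq, smul_eq_mul, mul_assoc]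
  have geo : Geo 61 G (G ⧸ normalizer (D : Set G)) (DL D) (QuotientGroup.mk 1) E := 
    { trans := fun x y => MulAction.exists_smul_eq G x y
      le_stab := by
        intro l d hd
        induction l using QuotientGroup.induction_on with
        | H x => 
          rw [mem_DL] at hd
          rw [hfix]
          exact le_normalizer hd
      conj := by
        intro g l d hd
        induction l using QuotientGroup.induction_on with
        | H x => 
          rw [mem_DL] at hd
          rw [MulAction.Quotient.smul_mk, mem_DL]
          convert hd using 1
          rw [smul_eq_mul]; group
      Eadd := H.add
      Einj := H.inj
      Erange := fun g => (hDl g).trans (H.range g)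
      homog := by
        intro a ha b hb ha1 hb1
        rw [hDl] at ha hb
        obtain ⟨g, hg, h⟩ := H.homog ha hb ha1 hb1
        exact ⟨g, (hfix _ _).2 (by simpa using hg), h⟩
      nofix := by
        intro l x hxl
        induction l using QuotientGroup.induction_on with
        | H y =>
        induction x using QuotientGroup.induction_on with
        | H x =>
        by_contra hcon
        push Not at hcon
        apply hxl
        have : y⁻¹ * x ∈ normalizer (D : Set G) := by
          refine H.nofix (card_syl hcard) hD hle ?_
          intro d hd e he
          have h1 := hcon (y * d * y⁻¹) (mem_DL.2 (by convert hd using 1; group))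
          rw [hfix] at h1
          have h2 := (mem_normalizer_iff.1 h1 e).1 he
          refine ⟨_, h2, ?_⟩
          change (y⁻¹ * x) * _ * (y⁻¹ * x)⁻¹ = _
          group
        exact (QuotientGroup.eq.2 this).symm
      cardL := hi }
  exact geo.final (hcard ▸ card_psl_ge)

end fin2
end ODL3


theorem L3_61_OD_characterizable (G : Type*) [Group G] [Finite G]
    (hcard : Nat.card G = 2 ^ 5 * 3 ^ 2 * 5 ^ 2 * 13 * 31 * 61 ^ 3 * 97)
    (hdeg2 : primeGraphDeg G 2 = 4)
    (hdeg3 : primeGraphDeg G 3 = 2)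
    (hdeg5 : primeGraphDeg G 5 = 4)
    (hdeg13 : primeGraphDeg G 13 = 1)
    (hdeg31 : primeGraphDeg G 31 = 2)
    (hdeg61 : primeGraphDeg G 61 = 2)
    (hdeg97 : primeGraphDeg G 97 = 1) :
    Nonempty (G ≃* PSL(3, ZMod 61)) := by
  have hF : ODL3.Few G := by
    classical
    intro a b c ha hb hc hab hac hbc
    have key : ∀ q, ODL3.Adj G q →
        q ∈ (Nat.card G).primeFactors.filter (fun r => primeGraphAdj G 61 r) := by
      rintro q ⟨hq, hq61, g, hg⟩
      have hd : 61 * q ∣ Nat.card G := hg ▸ orderOf_dvd_natCard g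
      have h61 : 61 ∣ Nat.card G := (Dvd.intro _ rfl).trans hd
      have hqd : q ∣ Nat.card G := (Dvd.intro_left _ rfl).trans hd
      rw [Finset.mem_filter]
      exact ⟨Nat.mem_primeFactors.2 ⟨hq, hqd, Nat.card_pos.ne'⟩,
        Ne.symm hq61, ODL3.p61, hq, h61, hqd, g, hg⟩
    have hsub : ({a, b, c} : Finset ℕ) ⊆
        (Nat.card G).primeFactors.filter (fun r => primeGraphAdj G 61 r) := by
      intro x hx
      simp only [Finset.mem_insert, Finset.mem_singleton] at hx
      rcases hx with rfl | rfl | rfl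
      · exact key _ ha
      · exact key _ hb
      · exact key _ hc
    have h1 := Finset.card_le_card hsub
    have h3 : ({a, b, c} : Finset ℕ).card = 3 := Finset.card_eq_three.2 ⟨a, b, c, hab, hac, hbc, rfl⟩
    have h2 : ((Nat.card G).primeFactors.filter (fun r => primeGraphAdj G 61 r)).card = 2 := by
      rw [← hdeg61]
      unfold primeGraphDeg
      congr
    omega
  exact ODL3.od_main hcard hF
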